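/- arXiv:math/0611503 — 2 statements merged into one kernel-verified Lean document; each statement's English description precedes it below -/
import Mathlib

section
/- (Carleson family characterization, sufficiency) Let 1 ≤ p < ∞ and let {μ_L}_{L ≥ 0} be positive Borel measures on S^d satisfying sup_{z ∈ S^d} μ_L(B(z, 1/L)) ≤ C/π_L for all L, where B(z,r) is the geodesic ball and π_L = dim Π_L. Then there is C' > 0 such that for all L and all Q ∈ Π_L: ∫_{S^d} |Q|^p dμ_L ≤ C' ∫_{S^d} |Q|^p dσ. -/
open MeasureTheory MvPolynomial
open scoped RealInnerProductSpace ENNReal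

noncomputable section

abbrev Esp (d : ℕ) : Type := EuclideanSpace ℝ (Fin (d+1))

abbrev Sph (d : ℕ) := Metric.sphere (0 : Esp d) 1

/-- The surface measure on the unit sphere `S^d`. -/
def sphMeasure (d : ℕ) : Measure (Sph d) := (volume : Measure (Esp d)).toSphere

/-- The Laplacian on polynomials in `d+1` variables. -/
def polyLap (d : ℕ) : MvPolynomial (Fin (d+1)) ℝ →ₗ[ℝ] MvPolynomial (Fin (d+1)) ℝ :=
  ∑ i : Fin (d+1), ((pderiv i).toLinearMap ∘ₗ (pderiv i).toLinearMap)

/-- Homogeneous harmonic polynomials of degree `ℓ` in `d+1` variables. -/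
def harmHomog (d ℓ : ℕ) : Submodule ℝ (MvPolynomial (Fin (d+1)) ℝ) :=
  homogeneousSubmodule (Fin (d+1)) ℝ ℓ ⊓ LinearMap.ker (polyLap d)

/-- Restriction of polynomials to the unit sphere, as a linear map. -/
def restrictSph (d : ℕ) : MvPolynomial (Fin (d+1)) ℝ →ₗ[ℝ] (Sph d → ℝ) where
  toFun P := fun x => eval (fun i => (x : Esp d) i) P
  map_add' P Q := by funext x; simp
  map_smul' r P := by funext x; simp [smul_eval]

/-- Spherical harmonics of degree `ℓ` on `S^d`. -/
def Hsp (d ℓ : ℕ) : Submodule ℝ (Sph d → ℝ) := (harmHomog d ℓ).map (restrictSph d)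

/-- Spherical harmonics of degree at most `L` on `S^d`. -/
def PiSp (d L : ℕ) : Submodule ℝ (Sph d → ℝ) := ⨆ ℓ : Fin (L+1), Hsp d ℓ

/-- Sums of homogeneous harmonic polynomials of degrees `≤ L` :
polynomial (harmonic-extension) model of `Π_L`. -/
def harmPolyLe (d L : ℕ) : Submodule ℝ (MvPolynomial (Fin (d+1)) ℝ) :=
  ⨆ ℓ : Fin (L+1), harmHomog d ℓ

/-- The north pole of `S^d`. -/
def north (d : ℕ) : Sph d :=
  ⟨EuclideanSpace.single 0 1, by
    simp [mem_sphere_zero_iff_norm, EuclideanSpace.norm_single]⟩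

/-- The geodesic distance on `S^d`. -/
def gdist (d : ℕ) (x y : Sph d) : ℝ := Real.arccos ⟪(x : Esp d), (y : Esp d)⟫

abbrev polyW (d D : ℕ) : Submodule ℝ (Sph d → ℝ) :=
  (restrictTotalDegree (Fin (d+1)) ℝ D).map (restrictSph d)


/-- Dirichlet-type kernel. -/
def dirK : ℕ → Polynomial ℝ
  | 0 => 1
  | (k+1) => dirK k + 2 * Polynomial.Chebyshev.T ℝ ((k:ℤ)+1)

/-- Fejer-type kernel. -/
def fejK (m : ℕ) : Polynomial ℝ := ∑ k ∈ Finset.range m, dirK k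

lemma dirK_mul (k : ℕ) : (1 - Polynomial.X) * dirK k =
    Polynomial.Chebyshev.T ℝ (k:ℤ) - Polynomial.Chebyshev.T ℝ ((k:ℤ)+1) := by
  induction k with
  | zero => simp [dirK]
  | succ k ih =>
    have h := Polynomial.Chebyshev.T_add_two ℝ (k:ℤ)
    have e : ((k+1:ℕ):ℤ)+1 = (k:ℤ)+2 := by push_cast; ring
    rw [e, h, dirK, mul_add, ih]; push_cast; ring

lemma fejK_mul (m : ℕ) : (1 - Polynomial.X) * fejK m = 1 - Polynomial.Chebyshev.T ℝ (m:ℤ) := by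
  induction m with
  | zero => simp [fejK]
  | succ k ih =>
    have : fejK (k+1) = fejK k + dirK k := by simp [fejK, Finset.sum_range_succ]
    rw [this, mul_add, ih, dirK_mul]; push_cast; ring

lemma dirK_one (k : ℕ) : (dirK k).eval 1 = 2*k+1 := by
  induction k with
  | zero => simp [dirK]
  | succ k ih => simp [dirK, ih]; ring

lemma dirK_abs (k : ℕ) {t : ℝ} (ht : |t| ≤ 1) : |(dirK k).eval t| ≤ 2*k+1 := by
  induction k with
  | zero => simp [dirK]
  | succ k ih =>
    have h := Polynomial.Chebyshev.abs_eval_T_real_le_one ((k:ℤ)+1) ht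
    have e : (dirK (k+1)).eval t = (dirK k).eval t
      + 2 * (Polynomial.Chebyshev.T ℝ ((k:ℤ)+1)).eval t := by simp [dirK]
    rw [e]
    refine (abs_add_le _ _).trans ?_
    rw [abs_mul]; push_cast; simp only [Nat.abs_ofNat]; linarith

lemma sum_odd (m : ℕ) : ∑ k ∈ Finset.range m, (2*(k:ℝ)+1) = m^2 := by
  induction m with
  | zero => simp
  | succ k ih => rw [Finset.sum_range_succ, ih]; push_cast; ring

lemma fejK_one (m : ℕ) : (fejK m).eval 1 = m^2 := by
  simp [fejK, Polynomial.eval_finsetSum, dirK_one, sum_odd]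

lemma fejK_abs (m : ℕ) {t : ℝ} (ht : |t| ≤ 1) : |(fejK m).eval t| ≤ m^2 := by
  rw [← sum_odd, fejK, Polynomial.eval_finsetSum]
  exact (Finset.abs_sum_le_sum_abs _ _).trans (Finset.sum_le_sum fun k _ => dirK_abs k ht)

lemma dirK_deg (k : ℕ) : (dirK k).natDegree ≤ k := by
  induction k with
  | zero => simp [dirK]
  | succ k ih =>
    rw [dirK]
    refine (Polynomial.natDegree_add_le _ _).trans (max_le (by omega) ?_)
    refine (Polynomial.natDegree_mul_le).trans ?_
    have : ((2 : Polynomial ℝ)).natDegree = 0 := Polynomial.natDegree_ofNat 2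
    rw [this, Polynomial.Chebyshev.natDegree_T]; omega

lemma fejK_deg (m : ℕ) : (fejK m).natDegree ≤ m := by
  apply Polynomial.natDegree_sum_le_of_forall_le
  intro k hk
  have := dirK_deg k
  have := Finset.mem_range.1 hk
  omega

/-- normalised localised kernel -/
lemma exists_kernel (N L : ℕ) (hL : 1 ≤ L) : ∃ G : Polynomial ℝ, G.natDegree ≤ N * L ∧
    G.eval 1 = 1 ∧ ∀ t s : ℝ, |t| ≤ 1 → 0 ≤ s → s^2 = 2 - 2 * t →
      |G.eval t| ≤ 10^N * ((1 + L * s)^(2*N))⁻¹ := by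
  have hLr : (1:ℝ) ≤ L := by exact_mod_cast hL
  refine ⟨(Polynomial.C ((L:ℝ)^2)⁻¹ * fejK L)^N, ?_, ?_, ?_⟩
  · refine Polynomial.natDegree_pow_le.trans ?_
    gcongr
    exact (Polynomial.natDegree_C_mul_le _ _).trans (fejK_deg L)
  · simp [fejK_one]
    rw [inv_mul_cancel₀ (by positivity), one_pow]
  · intro t s ht hs hst
    have hF := fejK_abs L ht
    have hT := Polynomial.Chebyshev.abs_eval_T_real_le_one (L:ℤ) ht
    have hm : (1 - t) * (fejK L).eval t = 1 - (Polynomial.Chebyshev.T ℝ (L:ℤ)).eval t := by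
      have := congrArg (Polynomial.eval t) (fejK_mul L)
      simpa using this
    have h1 : |(fejK L).eval t| * s^2 ≤ 4 := by
      have : |1 - t| * |(fejK L).eval t| ≤ 2 := by
        rw [← abs_mul, hm]; rw [abs_le] at *; constructor <;> linarith
      rw [abs_of_nonneg (by nlinarith)] at this
      rw [hst]; linarith
    rw [Polynomial.eval_pow, abs_pow, pow_mul, ← inv_pow ((1 + (L:ℝ) * s)^2), ← mul_pow]
    gcongr
    rw [Polynomial.eval_mul, Polynomial.eval_C, abs_mul, abs_of_nonneg (by positivity),
      ← div_eq_mul_inv, le_div_iff₀ (by positivity), mul_assoc, inv_mul_le_iff₀ (by positivity)]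
    set f := |(fejK L).eval t|
    have hf : 0 ≤ f := abs_nonneg _
    have h2 : (1 + L*s)^2 ≤ 2 + 2 * L^2 * s^2 := by nlinarith [sq_nonneg (1 - L*s)]
    calc f * (1 + L*s)^2 ≤ f * (2 + 2 * L^2 * s^2) := by gcongr
      _ = 2 * f + 2 * L^2 * (f * s^2) := by ring
      _ ≤ 2 * L^2 + 2 * L^2 * 4 := by gcongr
      _ = _ := by ring


def R2 (d : ℕ) : MvPolynomial (Fin (d+1)) ℝ := ∑ i, X i ^ 2

lemma R2_homog (d : ℕ) : (R2 d).IsHomogeneous 2 :=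
  IsHomogeneous.sum _ _ _ fun i _ => by simpa using (isHomogeneous_X ℝ i).pow 2

lemma pderiv_R2 (d : ℕ) (i : Fin (d+1)) : pderiv i (R2 d) = 2 * X i := by
  classical
  simp only [R2, map_sum, pderiv_pow]
  rw [Finset.sum_eq_single i]
  · simp
  · intro j _ hj; rw [pderiv_X_of_ne hj]; simp
  · simp

lemma polyLap_apply (d : ℕ) (f : MvPolynomial (Fin (d+1)) ℝ) :
    polyLap d f = ∑ i, pderiv i (pderiv i f) := by
  simp [polyLap]

lemma lap_R2_mul (d n : ℕ) (f : MvPolynomial (Fin (d+1)) ℝ) (hf : f.IsHomogeneous n) :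
    polyLap d (R2 d * f) = (2 * (d+1) + 4 * n : ℝ) • f + R2 d * polyLap d f := by
  have hE := hf.sum_X_mul_pderiv
  have h : ∀ i : Fin (d+1), pderiv i (pderiv i (R2 d * f)) =
      2 * f + 4 * (X i * pderiv i f) + R2 d * pderiv i (pderiv i f) := by
    intro i
    have h2 : pderiv i (2 : MvPolynomial (Fin (d+1)) ℝ) = 0 := by
      have : (2 : MvPolynomial (Fin (d+1)) ℝ) = C 2 := (map_ofNat C 2).symm
      rw [this, pderiv_C]
    simp only [pderiv_mul, pderiv_R2, map_add, pderiv_X_self, h2]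
    ring
  rw [polyLap_apply, polyLap_apply, Finset.sum_congr rfl (fun i _ => h i), Finset.sum_add_distrib,
    Finset.sum_add_distrib, ← Finset.mul_sum, ← Finset.mul_sum, hE, ← Finset.mul_sum]
  simp only [Finset.sum_const, Finset.card_univ, Fintype.card_fin, smul_eq_C_mul, nsmul_eq_mul]
  simp only [map_add, map_mul, map_natCast, map_ofNat, map_one]
  push_cast
  ring

lemma R2pow_homog (d j k : ℕ) (h : MvPolynomial (Fin (d+1)) ℝ) (hh : h.IsHomogeneous k) :
    (R2 d ^ j * h).IsHomogeneous (2 * j + k) :=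
  ((R2_homog d).pow j).mul hh

lemma R2_lap_pow (d j k : ℕ) (h : MvPolynomial (Fin (d+1)) ℝ) (hh : h ∈ harmHomog d k) :
    ∃ c : ℝ, 0 ≤ c ∧ R2 d * polyLap d (R2 d ^ j * h) = c • (R2 d ^ j * h) := by
  have h1 : h.IsHomogeneous k := hh.1
  have h2 : polyLap d h = 0 := hh.2
  induction j with
  | zero => exact ⟨0, le_rfl, by simp [h2]⟩
  | succ j ih =>
    obtain ⟨c, hc, e⟩ := ih
    refine ⟨(2 * (d+1) + 4 * ((2 * j + k : ℕ) : ℝ)) + c, by positivity, ?_⟩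
    have := lap_R2_mul d _ _ (R2pow_homog d j k h h1)
    rw [pow_succ', mul_assoc, this, e]
    simp only [smul_eq_C_mul, map_add]
    ring

lemma exists_lap_pow (d j k : ℕ) (h : MvPolynomial (Fin (d+1)) ℝ) (hh : h ∈ harmHomog d k) :
    ∃ c : ℝ, 0 < c ∧ polyLap d (R2 d ^ (j+1) * h) = c • (R2 d ^ j * h) := by
  obtain ⟨c, hc, e⟩ := R2_lap_pow d j k h hh
  have := lap_R2_mul d _ _ (R2pow_homog d j k h hh.1)
  refine ⟨(2 * (d+1) + 4 * ((2 * j + k : ℕ) : ℝ)) + c, by positivity, ?_⟩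
  rw [pow_succ', mul_assoc, this, e]
  simp only [smul_eq_C_mul, map_add]
  ring

def goodSp (d l : ℕ) : Submodule ℝ (MvPolynomial (Fin (d+1)) ℝ) :=
  Submodule.span ℝ {f | ∃ j k h, 2 * j + k = l ∧ h ∈ harmHomog d k ∧ f = R2 d ^ j * h}

lemma goodSp_homog (d l : ℕ) : goodSp d l ≤ homogeneousSubmodule (Fin (d+1)) ℝ l := by
  refine Submodule.span_le.2 ?_
  rintro f ⟨j, k, h, rfl, hh, rfl⟩
  exact R2pow_homog d j k h hh.1

lemma goodSp_solve (d l : ℕ) (f) (hf : f ∈ goodSp d l) : ∃ g ∈ goodSp d (l+2), polyLap d g = f := by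
  have : goodSp d l ≤ (goodSp d (l+2)).map (polyLap d) := by
    refine Submodule.span_le.2 ?_
    rintro f ⟨j, k, h, hl, hh, rfl⟩
    obtain ⟨c, hc, e⟩ := exists_lap_pow d j k h hh
    refine ⟨c⁻¹ • (R2 d ^ (j+1) * h), Submodule.smul_mem _ _ (Submodule.subset_span
      ⟨j+1, k, h, by omega, hh, rfl⟩), ?_⟩
    rw [map_smul, e, smul_smul, inv_mul_cancel₀ hc.ne', one_smul]
  obtain ⟨g, hg, e⟩ := this hf
  exact ⟨g, hg, e⟩

lemma pderiv_homog_zero {n : ℕ} (f : MvPolynomial (Fin n) ℝ) (hf : f.IsHomogeneous 0) (i) :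
    pderiv i f = 0 := by
  have h0 : f.totalDegree = 0 := by
    rcases eq_or_ne f 0 with rfl | h
    · simp
    · exact hf.totalDegree h
  rw [totalDegree_eq_zero_iff_eq_C.1 h0, pderiv_C]

lemma harm_good (d l : ℕ) : harmHomog d l ≤ goodSp d l :=
  fun h hh => Submodule.subset_span ⟨0, l, h, by omega, hh, by simp⟩

lemma homog_good (d l : ℕ) : homogeneousSubmodule (Fin (d+1)) ℝ l ≤ goodSp d l := by
  induction l using Nat.strong_induction_on with
  | _ l ih =>
  intro P hP
  have hP' : P.IsHomogeneous l := hP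
  rcases Nat.lt_or_ge l 2 with hl | hl
  · apply harm_good
    refine ⟨hP, ?_⟩
    rw [SetLike.mem_coe, LinearMap.mem_ker, polyLap_apply]
    refine Finset.sum_eq_zero fun i _ => pderiv_homog_zero _ ?_ i
    have := hP'.pderiv (i := i)
    have e : l - 1 = 0 := by omega
    rwa [e] at this
  · obtain ⟨m, rfl⟩ : ∃ m, l = m + 2 := ⟨l - 2, by omega⟩
    have h1 : polyLap d P ∈ goodSp d m := by
      apply ih m (by omega)
      rw [polyLap_apply]
      refine Submodule.sum_mem _ fun i _ => ?_
      exact (hP'.pderiv (i := i)).pderiv (i := i)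
    obtain ⟨g, hg, e⟩ := goodSp_solve d m _ h1
    have : P - g ∈ goodSp d (m+2) := by
      apply harm_good
      refine ⟨Submodule.sub_mem _ hP (goodSp_homog d _ hg), ?_⟩
      rw [SetLike.mem_coe, LinearMap.mem_ker, map_sub, e, sub_self]
    simpa using Submodule.add_mem _ this hg

lemma sph_sum_sq (d : ℕ) (x : Sph d) : ∑ i, (x : Esp d) i ^ 2 = 1 := by
  have h := x.2
  rw [mem_sphere_zero_iff_norm] at h
  have := EuclideanSpace.real_norm_sq_eq (x : Esp d)
  rw [h] at this
  linarith

lemma good_restrict (d l L : ℕ) (hl : l ≤ L) : (goodSp d l).map (restrictSph d) ≤ PiSp d L := by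
  rw [goodSp, Submodule.map_span_le]
  rintro f ⟨j, k, h, hjk, hh, rfl⟩
  have : restrictSph d (R2 d ^ j * h) = restrictSph d h := by
    funext x
    simp [restrictSph, R2, sph_sum_sq]
  rw [this]
  have h1 : Hsp d ((⟨k, by omega⟩ : Fin (L+1)) : ℕ) ≤ PiSp d L :=
    le_iSup (fun l : Fin (L+1) => Hsp d l) ⟨k, by omega⟩
  exact h1 ⟨h, hh, rfl⟩

lemma PiSp_eq (d L : ℕ) : PiSp d L = polyW d L := by
  apply le_antisymm
  · refine iSup_le fun l => Submodule.map_mono fun f hf => ?_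
    rw [mem_restrictTotalDegree]
    have : f.IsHomogeneous l := hf.1
    exact this.totalDegree_le.trans (by omega)
  · rintro _ ⟨P, hP, rfl⟩
    have hP' := (mem_restrictTotalDegree _ _ _).1 hP
    rw [← sum_homogeneousComponent P, map_sum]
    refine Submodule.sum_mem _ fun i hi => ?_
    have hi' := Finset.mem_range.1 hi
    exact good_restrict d i L (by omega) ⟨_, homog_good d i (homogeneousComponent_isHomogeneous i P), rfl⟩

lemma sph_lift (d : ℕ) (y : Fin d → ℝ) (hy : ∑ i, y i ^ 2 ≤ 1) :
    ∃ x : Sph d, ∀ i : Fin d, (x : Esp d) i.succ = y i := by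
  refine ⟨⟨WithLp.toLp 2 (Fin.cons (√(1 - ∑ i, y i ^ 2)) y), ?_⟩, fun i => by simp⟩
  rw [mem_sphere_zero_iff_norm, ← sq_eq_sq₀ (norm_nonneg _) zero_le_one,
    EuclideanSpace.real_norm_sq_eq, Fin.sum_univ_succ]
  simp only [Fin.cons_zero, Fin.cons_succ]
  rw [Real.sq_sqrt (by linarith)]
  ring

lemma rename_inj (d : ℕ) (P : MvPolynomial (Fin d) ℝ)
    (h : restrictSph d (rename Fin.succ P) = 0) : P = 0 := by
  apply funext_set (fun _ => Set.Icc (0:ℝ) (1/(d+1))) (fun _ => Set.Icc_infinite (by positivity))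
  intro y hy
  have hy' : ∀ i, 0 ≤ y i ∧ y i ≤ 1/(d+1) := fun i => hy i (Set.mem_univ i)
  have hs : ∑ i, y i ^ 2 ≤ 1 := by
    calc ∑ i, y i ^ 2 ≤ ∑ i : Fin d, 1/((d:ℝ)+1) := by
          gcongr with i
          have := hy' i
          have h1 : 1/((d:ℝ)+1) ≤ 1 := by
            rw [div_le_one (by positivity)]; linarith [(Nat.cast_nonneg d : (0:ℝ) ≤ d)]
          nlinarith
      _ = d/(d+1) := by simp; ring
      _ ≤ 1 := by rw [div_le_one (by positivity)]; linarith
  obtain ⟨x, hx⟩ := sph_lift d y hs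
  have := congrFun h x
  simp only [restrictSph, LinearMap.coe_mk, AddHom.coe_mk, eval_rename, Pi.zero_apply] at this
  rw [map_zero, ← this]
  congr 2
  funext i
  exact (hx i).symm

instance polyW_fin (d D : ℕ) : FiniteDimensional ℝ (polyW d D) := by
  unfold polyW; infer_instance

lemma dim_lower (d L : ℕ) : (L/d + 1)^d ≤ Module.finrank ℝ (PiSp d L) := by
  rw [PiSp_eq]
  let mon : (Fin d → Fin (L/d+1)) → (Fin d →₀ ℕ) := fun a => Finsupp.equivFunOnFinite.symm fun i => a i
  have hmon : Function.Injective mon := by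
    intro a b hab
    funext i
    have := DFunLike.congr_fun hab i
    simpa [mon, Fin.ext_iff] using this
  let T : MvPolynomial (Fin d) ℝ →ₗ[ℝ] (Sph d → ℝ) :=
    restrictSph d ∘ₗ (rename Fin.succ : MvPolynomial (Fin d) ℝ →ₐ[ℝ] _).toLinearMap
  have hT : LinearMap.ker T = ⊥ := by
    rw [LinearMap.ker_eq_bot']
    intro P hP
    exact rename_inj d P hP
  have h1 : LinearIndependent ℝ (fun a => T (monomial (mon a) 1)) := by
    have := ((basisMonomials (Fin d) ℝ).linearIndependent.comp mon hmon).map' T hT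
    simpa [Function.comp_def] using this
  have hmem : ∀ a, T (monomial (mon a) 1) ∈ polyW d L := by
    intro a
    refine ⟨rename Fin.succ (monomial (mon a) 1), ?_, rfl⟩
    rw [SetLike.mem_coe, mem_restrictTotalDegree]
    refine (totalDegree_rename_le _ _).trans ((totalDegree_monomial_le _ _).trans ?_)
    rw [Finsupp.sum_fintype _ _ (by simp)]
    calc ∑ i, (mon a) i ≤ ∑ i : Fin d, L/d := Finset.sum_le_sum fun i _ => by
            have := (a i).2
            simp [mon]; omega
      _ = d * (L/d) := by simp
      _ ≤ L := Nat.mul_div_le L d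
  have h2 : LinearIndependent ℝ (fun a => (⟨_, hmem a⟩ : polyW d L)) :=
    LinearIndependent.of_comp (polyW d L).subtype h1
  have := h2.fintype_card_le_finrank
  simpa using this

lemma dim_upper (d D : ℕ) : Module.finrank ℝ (polyW d D) ≤ 2 * (D+1)^d := by
  let v : Fin 2 × (Fin d → Fin (D+1)) → (Sph d → ℝ) := fun q x =>
    (x : Esp d) 0 ^ (q.1 : ℕ) * ∏ i, (x : Esp d) i.succ ^ (q.2 i : ℕ)
  have key : ∀ k : ℕ, ∀ a : Fin d → ℕ, k + ∑ i, a i ≤ D →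
      (fun x : Sph d => (x : Esp d) 0 ^ k * ∏ i, (x : Esp d) i.succ ^ a i) ∈
        Submodule.span ℝ (Set.range v) := by
    intro k
    induction k using Nat.strong_induction_on with
    | _ k ih =>
    intro a ha
    rcases Nat.lt_or_ge k 2 with hk | hk
    · apply Submodule.subset_span
      have hai : ∀ i, a i < D + 1 := fun i => by
        have := Finset.single_le_sum (f := a) (fun _ _ => Nat.zero_le _) (Finset.mem_univ i)
        omega
      exact ⟨(⟨k, hk⟩, fun i => ⟨a i, hai i⟩), rfl⟩
    · obtain ⟨m, rfl⟩ : ∃ m, k = m + 2 := ⟨k - 2, by omega⟩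
      have e : (fun x : Sph d => (x : Esp d) 0 ^ (m+2) * ∏ i, (x : Esp d) i.succ ^ a i) =
          (fun x : Sph d => (x : Esp d) 0 ^ m * ∏ i, (x : Esp d) i.succ ^ a i) -
          ∑ j : Fin d, (fun x : Sph d => (x : Esp d) 0 ^ m *
            ∏ i : Fin d, (x : Esp d) i.succ ^ ((a + Pi.single j 2 : Fin d → ℕ) i)) := by
        funext x
        have hx := sph_sum_sq d x
        rw [Fin.sum_univ_succ] at hx
        have hj : ∀ j : Fin d, ∏ i : Fin d, (x : Esp d) i.succ ^ ((a + Pi.single j 2 : Fin d → ℕ) i) =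
            (x : Esp d) j.succ ^ 2 * ∏ i, (x : Esp d) i.succ ^ a i := by
          intro j
          simp only [Pi.add_apply, pow_add, Finset.prod_mul_distrib]
          rw [mul_comm]
          congr 1
          rw [Finset.prod_eq_single j]
          · simp
          · intro i _ hi; simp [Pi.single_eq_of_ne hi]
          · simp
        simp only [Pi.sub_apply, Finset.sum_apply, hj]
        rw [← Finset.mul_sum, ← Finset.sum_mul]
        have : (x : Esp d) 0 ^ 2 = 1 - ∑ i : Fin d, (x : Esp d) i.succ ^ 2 := by linarith
        rw [pow_add, this]; ring
      rw [e]
      refine Submodule.sub_mem _ (ih m (by omega) a (by omega)) (Submodule.sum_mem _ fun j _ =>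
        ih m (by omega) _ ?_)
      simp only [Pi.add_apply, Finset.sum_add_distrib]
      rw [Finset.sum_pi_single' j 2 Finset.univ]
      simp; omega
  have hle : polyW d D ≤ Submodule.span ℝ (Set.range v) := by
    rintro _ ⟨P, hP, rfl⟩
    have hP' := (mem_restrictTotalDegree _ _ _).1 hP
    rw [P.as_sum, map_sum]
    refine Submodule.sum_mem _ fun m hm => ?_
    have hdeg : m.sum (fun _ e => e) ≤ D := (le_totalDegree hm).trans hP'
    rw [Finsupp.sum_fintype _ _ (by simp), Fin.sum_univ_succ] at hdeg
    have e : restrictSph d (monomial m (coeff m P)) = coeff m P •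
        (fun x : Sph d => (x : Esp d) 0 ^ (m 0) * ∏ i : Fin d, (x : Esp d) i.succ ^ (m i.succ)) := by
      funext x
      simp [restrictSph, eval_monomial, Finsupp.prod_fintype, Fin.prod_univ_succ]
    rw [e]
    exact Submodule.smul_mem _ _ (key _ _ hdeg)
  have hfin : FiniteDimensional ℝ (Submodule.span ℝ (Set.range v)) :=
    FiniteDimensional.span_of_finite ℝ (Set.finite_range v)
  calc _ ≤ Module.finrank ℝ (Submodule.span ℝ (Set.range v)) := Submodule.finrank_mono hle
    _ ≤ _ := (finrank_range_le_card v)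
    _ = _ := by simp


lemma polyW_cont (d D : ℕ) {f : Sph d → ℝ} (hf : f ∈ polyW d D) : Continuous f := by
  obtain ⟨P, -, rfl⟩ := hf
  have : Continuous fun x : Sph d => eval (fun i => (x : Esp d) i) P :=
    (MvPolynomial.continuous_eval P).comp (by fun_prop)
  exact this

lemma polyW_mono (d : ℕ) {D D' : ℕ} (h : D ≤ D') : polyW d D ≤ polyW d D' :=
  Submodule.map_mono fun f hf => by
    rw [mem_restrictTotalDegree] at *; omega

lemma polyW_mul (d : ℕ) {D D' : ℕ} {f g : Sph d → ℝ} (hf : f ∈ polyW d D) (hg : g ∈ polyW d D') :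
    f * g ∈ polyW d (D + D') := by
  obtain ⟨P, hP, rfl⟩ := hf
  obtain ⟨Q, hQ, rfl⟩ := hg
  refine ⟨P * Q, ?_, ?_⟩
  · rw [SetLike.mem_coe, mem_restrictTotalDegree] at *
    exact (totalDegree_mul _ _).trans (by omega)
  · funext x; simp [restrictSph]

lemma polyW_const (d : ℕ) (c : ℝ) : (fun _ => c : Sph d → ℝ) ∈ polyW d 0 :=
  ⟨C c, by rw [SetLike.mem_coe, mem_restrictTotalDegree]; simp, by funext x; simp [restrictSph]⟩

lemma polyW_lin (d : ℕ) (c : Fin (d+1) → ℝ) :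
    (fun x => ∑ i, c i * (x : Esp d) i : Sph d → ℝ) ∈ polyW d 1 := by
  refine ⟨∑ i, C (c i) * X i, ?_, by funext x; simp [restrictSph]⟩
  refine Submodule.sum_mem _ fun i _ => ?_
  rw [mem_restrictTotalDegree]
  exact (totalDegree_mul _ _).trans (by simp)

lemma polyW_pow (d : ℕ) {D : ℕ} {f : Sph d → ℝ} (hf : f ∈ polyW d D) (n : ℕ) :
    f ^ n ∈ polyW d (n * D) := by
  induction n with
  | zero => rw [pow_zero, zero_mul]; exact polyW_const d 1
  | succ n ih => rw [pow_succ, add_mul, one_mul]; exact polyW_mul d ih hf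

lemma polyW_prod (d : ℕ) {ι : Type} (s : Finset ι) (D : ι → ℕ) (f : ι → Sph d → ℝ)
    (hf : ∀ i ∈ s, f i ∈ polyW d (D i)) : ∏ i ∈ s, f i ∈ polyW d (∑ i ∈ s, D i) := by
  classical
  induction s using Finset.induction_on with
  | empty => exact polyW_const d 1
  | insert a s ha ih =>
    rw [Finset.prod_insert ha, Finset.sum_insert ha]
    exact polyW_mul d (hf a (by simp)) (ih fun i hi => hf i (by simp [hi]))

lemma polyW_poly (d : ℕ) {f : Sph d → ℝ} (hf : f ∈ polyW d 1) (G : Polynomial ℝ) {D : ℕ}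
    (hG : G.natDegree ≤ D) : (fun x => G.eval (f x)) ∈ polyW d D := by
  have : (fun x => G.eval (f x)) = ∑ i ∈ Finset.range (G.natDegree + 1), G.coeff i • f ^ i := by
    funext x
    rw [Polynomial.eval_eq_sum_range]
    simp
  rw [this]
  refine Submodule.sum_mem _ fun i hi => Submodule.smul_mem _ _ ?_
  have := Finset.mem_range.1 hi
  exact polyW_mono d (by omega) (polyW_pow d hf i)

/-- action of an isometry on the sphere -/
def rotS (d : ℕ) (R : Esp d ≃ₗᵢ[ℝ] Esp d) (x : Sph d) : Sph d :=
  ⟨R x, by rw [mem_sphere_zero_iff_norm, R.norm_map]; exact mem_sphere_zero_iff_norm.1 x.2⟩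

lemma rotS_cont (d : ℕ) (R : Esp d ≃ₗᵢ[ℝ] Esp d) : Continuous (rotS d R) :=
  Continuous.subtype_mk (R.continuous.comp continuous_subtype_val) _

lemma polyW_rot (d D : ℕ) (R : Esp d ≃ₗᵢ[ℝ] Esp d) {f : Sph d → ℝ} (hf : f ∈ polyW d D) :
    f ∘ rotS d R ∈ polyW d D := by
  have hc : ∀ i : Fin (d+1), (fun x : Sph d => (R (x : Esp d)) i) ∈ polyW d 1 := by
    intro i
    have : (fun x : Sph d => (R (x : Esp d)) i) =
        fun x : Sph d => ∑ j, (R (EuclideanSpace.single j 1)) i * (x : Esp d) j := by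
      funext x
      have e : (x : Esp d) = ∑ j, (x : Esp d) j • EuclideanSpace.single j (1:ℝ) := by
        ext i
        simp [Finset.sum_apply, Pi.single_apply]
      conv_lhs => rw [e]
      simp [mul_comm]
    rw [this]
    exact polyW_lin d _
  obtain ⟨P, hP, rfl⟩ := hf
  have hP' := (mem_restrictTotalDegree _ _ _).1 hP
  have : restrictSph d P ∘ rotS d R =
      ∑ m ∈ P.support, coeff m P • ∏ i, (fun x : Sph d => (R (x : Esp d)) i) ^ m i := by
    funext x
    simp [restrictSph, rotS, eval_eq']
  rw [this]
  refine Submodule.sum_mem _ fun m hm => Submodule.smul_mem _ _ ?_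
  have hdeg : m.sum (fun _ e => e) ≤ D := (le_totalDegree hm).trans hP'
  rw [Finsupp.sum_fintype _ _ (by simp)] at hdeg
  refine polyW_mono d hdeg (polyW_prod d _ _ _ fun i _ => ?_)
  simpa using polyW_pow d (hc i) (m i)

open scoped Pointwise in
lemma rotS_mp (d : ℕ) (R : Esp d ≃ₗᵢ[ℝ] Esp d) :
    MeasurePreserving (rotS d R) (sphMeasure d) (sphMeasure d) := by
  refine ⟨(rotS_cont d R).measurable, ?_⟩
  ext s hs
  rw [Measure.map_apply (rotS_cont d R).measurable hs, sphMeasure, Measure.toSphere_apply' _ hs,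
    Measure.toSphere_apply' _ ((rotS_cont d R).measurable hs)]
  congr 1
  have : Set.Ioo (0:ℝ) 1 • (Subtype.val '' (rotS d R ⁻¹' s) : Set (Esp d)) =
      R ⁻¹' (Set.Ioo (0:ℝ) 1 • (Subtype.val '' s)) := by
    ext y
    simp only [Set.mem_smul, Set.mem_preimage, Set.mem_image]
    constructor
    · rintro ⟨r, hr, _, ⟨x, hx, rfl⟩, rfl⟩
      exact ⟨r, hr, _, ⟨_, hx, rfl⟩, by simp [rotS]⟩
    · rintro ⟨r, hr, _, ⟨x, hx, rfl⟩, h⟩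
      refine ⟨r, hr, _, ⟨rotS d R.symm x, ?_, rfl⟩, ?_⟩
      · have : rotS d R (rotS d R.symm x) = x := by ext; simp [rotS]
        rw [this]; exact hx
      · apply R.injective
        simp [rotS, ← h]
  rw [this]
  exact (LinearIsometryEquiv.measurePreserving R).measure_preimage_emb
    R.toHomeomorph.measurableEmbedding _

lemma rotS_integral (d : ℕ) (R : Esp d ≃ₗᵢ[ℝ] Esp d) (f : Sph d → ℝ) (hf : Continuous f) :
    ∫ x, f (rotS d R x) ∂(sphMeasure d) = ∫ x, f x ∂(sphMeasure d) := by
  conv_rhs => rw [← (rotS_mp d R).map_eq]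
  rw [integral_map (rotS_cont d R).aemeasurable hf.aestronglyMeasurable]

lemma rotS_trans (d : ℕ) (z w : Sph d) : ∃ R, rotS d R z = w := by
  have hz := mem_sphere_zero_iff_norm.1 z.2
  have hw := mem_sphere_zero_iff_norm.1 w.2
  exact ⟨Submodule.reflection (ℝ ∙ ((z:Esp d) - w))ᗮ, Subtype.ext (Submodule.reflection_sub (hz.trans hw.symm))⟩

instance sph_fin (d : ℕ) : IsFiniteMeasure (sphMeasure d) := by unfold sphMeasure; infer_instance
instance sph_open (d : ℕ) : (sphMeasure d).IsOpenPosMeasure := by unfold sphMeasure; infer_instance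

lemma cont_int (d : ℕ) {f : Sph d → ℝ} (hf : Continuous f) : Integrable f (sphMeasure d) :=
  hf.integrable_of_hasCompactSupport (HasCompactSupport.of_compactSpace f)

/-- L² form -/
def l2form (d D : ℕ) : LinearMap.BilinForm ℝ (polyW d D) :=
  LinearMap.mk₂ ℝ (fun f g => ∫ x, f.1 x * g.1 x ∂(sphMeasure d))
    (fun f f' g => by
      have h1 := polyW_cont d D f.2
      have h2 := polyW_cont d D f'.2
      have h3 := polyW_cont d D g.2
      rw [← integral_add (cont_int d (by fun_prop)) (cont_int d (by fun_prop))]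
      simp [add_mul])
    (fun c f g => by
      rw [smul_eq_mul, ← integral_const_mul]
      simp [mul_assoc])
    (fun f g g' => by
      have h1 := polyW_cont d D f.2
      have h2 := polyW_cont d D g.2
      have h3 := polyW_cont d D g'.2
      rw [← integral_add (cont_int d (by fun_prop)) (cont_int d (by fun_prop))]
      simp [mul_add])
    (fun c f g => by
      rw [smul_eq_mul, ← integral_const_mul]
      simp [mul_left_comm])

lemma l2form_apply (d D : ℕ) (f g : polyW d D) :
    l2form d D f g = ∫ x, f.1 x * g.1 x ∂(sphMeasure d) := rfl

lemma l2form_pos (d D : ℕ) (f : polyW d D) (hf : f ≠ 0) : 0 < l2form d D f f := by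
  rw [l2form_apply]
  have hc := polyW_cont d D f.2
  have : ∃ x, f.1 x ≠ 0 := by
    by_contra! h
    exact hf (Subtype.ext (funext h))
  obtain ⟨x, hx⟩ := this
  exact Continuous.integral_pos_of_hasCompactSupport_nonneg_nonzero (by fun_prop)
    (HasCompactSupport.of_compactSpace _) (fun y => mul_self_nonneg _) (x := x) (mul_self_ne_zero.2 hx)

lemma nikolskii2 (d D : ℕ) (f : Sph d → ℝ) (hf : f ∈ polyW d D) (z : Sph d) :
    (sphMeasure d).real Set.univ * f z ^ 2 ≤
      Module.finrank ℝ (polyW d D) * ∫ x, f x ^ 2 ∂(sphMeasure d) := by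
  have hsymm : LinearMap.IsSymm (l2form d D) := ⟨fun f g => by
    simp [l2form_apply, mul_comm]⟩
  obtain ⟨v, hv⟩ := LinearMap.BilinForm.exists_orthogonal_basis hsymm
  set b : Fin (Module.finrank ℝ (polyW d D)) → ℝ := fun i => l2form d D (v i) (v i) with hb
  have hbpos : ∀ i, 0 < b i := fun i => l2form_pos d D _ (v.ne_zero i)
  have hvc : ∀ i, Continuous (v i).1 := fun i => polyW_cont d D (v i).2
  set k : Sph d → ℝ := fun x => ∑ i, (v i).1 x ^ 2 / b i with hk
  -- norm of combos
  have hnorm : ∀ c : Fin (Module.finrank ℝ (polyW d D)) → ℝ,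
      ∫ x, (∑ i, c i * (v i).1 x) ^ 2 ∂(sphMeasure d) = ∑ i, c i ^ 2 * b i := by
    intro c
    have e : ∫ x, (∑ i, c i * (v i).1 x) ^ 2 ∂(sphMeasure d) =
        l2form d D (∑ i, c i • v i) (∑ i, c i • v i) := by
      rw [l2form_apply]
      congr 1; funext x
      simp [sq]
    rw [e]
    simp only [map_sum, LinearMap.sum_apply, map_smul, LinearMap.smul_apply, smul_eq_mul]
    refine Finset.sum_congr rfl fun i _ => ?_
    rw [Finset.sum_eq_single i]
    · rw [hb]; ring
    · intro j _ hj
      have : l2form d D (v j) (v i) = 0 := hv hj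
      simp [this]
    · simp
  -- Cauchy–Schwarz
  have hCS : ∀ g ∈ polyW d D, ∀ x, g x ^ 2 ≤ (∫ y, g y ^ 2 ∂(sphMeasure d)) * k x := by
    intro g hg x
    have e : ∀ y, g y = ∑ i, v.repr ⟨g, hg⟩ i * (v i).1 y := by
      intro y
      have h := congrArg Subtype.val (v.sum_repr ⟨g, hg⟩)
      have h2 := congrFun h y
      simp only [AddSubmonoidClass.coe_finsetSum, Submodule.coe_smul, Finset.sum_apply, Pi.smul_apply, smul_eq_mul] at h2
      exact h2.symm
    have e2 : ∫ y, g y ^ 2 ∂(sphMeasure d) = ∑ i, (v.repr ⟨g, hg⟩ i) ^ 2 * b i := by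
      rw [← hnorm]; simp_rw [← e]
    rw [e2, e x, hk]
    refine Finset.sum_sq_le_sum_mul_sum_of_sq_le_mul _ (fun i _ => ?_) (fun i _ => ?_) fun i _ => ?_
    · have := hbpos i; positivity
    · have := hbpos i; positivity
    · have := hbpos i; apply le_of_eq; field_simp
  have hk0 : ∀ x, 0 ≤ k x := fun x => Finset.sum_nonneg fun i _ => by
    have := hbpos i; positivity
  have hkc : Continuous k := by
    apply continuous_finsetSum; intro i _; have := hvc i; fun_prop
  -- k is constant
  have hkle : ∀ x y, k x ≤ k y := by
    intro x y
    obtain ⟨R, rfl⟩ := rotS_trans d y x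
    rcases (hk0 (rotS d R y)).eq_or_lt with h0 | h0
    · rw [← h0]; exact hk0 y
    set g : Sph d → ℝ := fun w => ∑ i, ((v i).1 (rotS d R y) / b i) * (v i).1 w with hg
    have hgm : g ∈ polyW d D := by
      have : g = ∑ i, ((v i).1 (rotS d R y) / b i) • (v i).1 := by
        funext w; simp [hg]
      rw [this]
      exact Submodule.sum_mem _ fun i _ => Submodule.smul_mem _ _ (v i).2
    have h1 := hCS _ (polyW_rot d D R hgm) y
    have h2 : ∫ w, (g ∘ rotS d R) w ^ 2 ∂(sphMeasure d) = k (rotS d R y) := by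
      have := rotS_integral d R (fun w => g w ^ 2) ((polyW_cont d D hgm).pow 2)
      simp only [Function.comp]
      rw [this, hg, hnorm, hk]
      refine Finset.sum_congr rfl fun i _ => ?_
      have := hbpos i; field_simp
    have h3 : (g ∘ rotS d R) y = k (rotS d R y) := by
      simp only [Function.comp, hg, hk]
      refine Finset.sum_congr rfl fun i _ => by ring
    rw [h2, h3, sq] at h1
    exact le_of_mul_le_mul_left h1 h0
  have hkint : ∫ x, k x ∂(sphMeasure d) = Module.finrank ℝ (polyW d D) := by
    rw [hk, integral_finsetSum _ (fun i _ => cont_int d (by have := hvc i; fun_prop))]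
    have : ∀ i, ∫ x, (v i).1 x ^ 2 / b i ∂(sphMeasure d) = 1 := by
      intro i
      rw [integral_div, div_eq_one_iff_eq (hbpos i).ne']
      simp [hb, l2form_apply, sq]
    simp [this]
  have hfin : (sphMeasure d).real Set.univ * k z ≤ Module.finrank ℝ (polyW d D) := by
    rw [← hkint]
    have : ∫ x, k z ∂(sphMeasure d) ≤ ∫ x, k x ∂(sphMeasure d) :=
      integral_mono (integrable_const _) (cont_int d hkc) (fun x => hkle z x)
    simpa using this
  have hI : 0 ≤ ∫ x, f x ^ 2 ∂(sphMeasure d) := integral_nonneg fun x => sq_nonneg _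
  calc _ ≤ (sphMeasure d).real Set.univ * ((∫ y, f y ^ 2 ∂(sphMeasure d)) * k z) := by
        gcongr; exact hCS f hf z
    _ = ((sphMeasure d).real Set.univ * k z) * (∫ y, f y ^ 2 ∂(sphMeasure d)) := by ring
    _ ≤ _ := by gcongr

lemma nikolskii1 (d D : ℕ) (f : Sph d → ℝ) (hf : f ∈ polyW d D) (z : Sph d) :
    (sphMeasure d).real Set.univ * |f z| ≤
      Module.finrank ℝ (polyW d D) * ∫ x, |f x| ∂(sphMeasure d) := by
  have hc := polyW_cont d D hf
  have : Nonempty (Sph d) := ⟨z⟩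
  obtain ⟨w, hw⟩ := (isCompact_univ (X := Sph d)).exists_isMaxOn ⟨z, trivial⟩ hc.abs.continuousOn
  have hw : ∀ x, |f x| ≤ |f w| := fun x => hw.2 (Set.mem_univ x)
  have h2 := nikolskii2 d D f hf w
  have hI : ∫ x, f x ^ 2 ∂(sphMeasure d) ≤ |f w| * ∫ x, |f x| ∂(sphMeasure d) := by
    rw [← integral_const_mul]
    refine integral_mono (cont_int d (by fun_prop)) (cont_int d (by fun_prop)) fun x => ?_
    simp only
    rw [← sq_abs, sq]
    exact mul_le_mul_of_nonneg_right (hw x) (abs_nonneg _)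
  have hI0 : 0 ≤ ∫ x, |f x| ∂(sphMeasure d) := integral_nonneg fun x => abs_nonneg _
  rcases (abs_nonneg (f w)).eq_or_lt with h0 | h0
  · have : |f z| ≤ 0 := (hw z).trans h0.ge
    have : |f z| = 0 := le_antisymm this (abs_nonneg _)
    rw [this, mul_zero]; positivity
  · calc _ ≤ (sphMeasure d).real Set.univ * |f w| := mul_le_mul_of_nonneg_left (hw z) measureReal_nonneg
      _ ≤ _ := by
        refine le_of_mul_le_mul_left ?_ h0
        calc |f w| * ((sphMeasure d).real Set.univ * |f w|)
            = (sphMeasure d).real Set.univ * f w ^ 2 := by rw [← sq_abs]; ring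
          _ ≤ _ := h2
          _ ≤ Module.finrank ℝ (polyW d D) * (|f w| * ∫ x, |f x| ∂(sphMeasure d)) := by gcongr
          _ = _ := by ring


/-- decaying kernel -/
def dk (d M L : ℕ) (x w : Esp d) : ℝ := ((1 + L * ‖x - w‖) ^ M)⁻¹

lemma dk_nonneg (d M L : ℕ) (x w : Esp d) : 0 ≤ dk d M L x w := by unfold dk; positivity

lemma dk_cont (d M L : ℕ) : Continuous fun q : Esp d × Esp d => dk d M L q.1 q.2 := by
  unfold dk
  refine Continuous.inv₀ (by fun_prop) fun q => ?_
  positivity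

def I1 (d M : ℕ) : ℝ≥0∞ := ∫⁻ x : Esp d, ENNReal.ofReal (dk d M 1 x 0)

lemma I1_lt (d M : ℕ) (hM : d + 1 < M) : I1 d M < ∞ := by
  have h := finite_integral_one_add_norm (E := Esp d) (μ := volume) (r := M) (by
    simp; exact_mod_cast hM)
  refine lt_of_eq_of_lt ?_ h
  unfold I1
  congr 1; funext x
  unfold dk
  rw [Real.rpow_neg (by positivity), Real.rpow_natCast]; simp

lemma lint_dk (d M L : ℕ) (hL : 1 ≤ L) (w : Esp d) :
    ∫⁻ x, ENNReal.ofReal (dk d M L x w) = ENNReal.ofReal (((L:ℝ)^(d+1))⁻¹) * I1 d M := by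
  have hL0 : (L:ℝ) ≠ 0 := by positivity
  have e1 : ∫⁻ x, ENNReal.ofReal (dk d M L x w) = ∫⁻ x, ENNReal.ofReal (dk d M L x 0) := by
    have := lintegral_sub_right_eq_self (μ := (volume : Measure (Esp d)))
      (fun x => ENNReal.ofReal (dk d M L x 0)) w
    rw [← this]
    simp [dk]
  have e2 : ∀ x : Esp d, dk d M L x 0 = dk d M 1 ((L:ℝ) • x) 0 := by
    intro x; simp [dk, norm_smul]
  have hm : Measurable fun x : Esp d => ENNReal.ofReal (dk d M 1 x 0) := by
    apply ENNReal.measurable_ofReal.comp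
    exact ((dk_cont d M 1).comp (by fun_prop : Continuous fun x : Esp d => (x, (0 : Esp d)))).measurable
  have e3 := lintegral_map (μ := (volume : Measure (Esp d))) hm
    (measurable_const_smul (L:ℝ) : Measurable fun x : Esp d => (L:ℝ) • x)
  rw [e1]
  simp_rw [e2]
  rw [← e3, Measure.map_addHaar_smul _ hL0, lintegral_smul_measure, I1]
  simp

lemma vol_ball (d : ℕ) (x : Esp d) (r : ℝ) (hr : 0 ≤ r) : volume (Metric.ball x r) =
    ENNReal.ofReal (r^(d+1)) * volume (Metric.ball (0 : Esp d) 1) := by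
  rw [Measure.addHaar_ball _ _ hr]; simp

def KK (d M : ℕ) : ℝ≥0∞ :=
  (ENNReal.ofReal (2^M * 4^(d+1)) * I1 d M) / volume (Metric.ball (0 : Esp d) 1)

lemma v1_pos (d : ℕ) : volume (Metric.ball (0 : Esp d) 1) ≠ 0 :=
  (Metric.measure_ball_pos _ _ one_pos).ne'

lemma v1_fin (d : ℕ) : volume (Metric.ball (0 : Esp d) 1) ≠ ∞ := measure_ball_lt_top.ne

lemma KK_lt (d M : ℕ) (hM : d + 1 < M) : KK d M ≠ ∞ := by
  unfold KK
  exact ENNReal.div_ne_top (ENNReal.mul_ne_top ENNReal.ofReal_ne_top (I1_lt d M hM).ne) (v1_pos d)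

lemma lint_alg (d M L : ℕ) (hL : 1 ≤ L) (κ J : ℝ≥0∞)
    (step3 : ENNReal.ofReal ((1/(4*L:ℝ))^(d+1)) * volume (Metric.ball (0 : Esp d) 1) *
      J ≤ ENNReal.ofReal (2^M) *
      (ENNReal.ofReal (((L:ℝ)^(d+1))⁻¹) * I1 d M) * κ) : J ≤ KK d M * κ := by
  have hLr : (1:ℝ) ≤ L := by exact_mod_cast hL
  have hA0 : ENNReal.ofReal ((1/(4*L:ℝ))^(d+1)) ≠ 0 := by
    rw [Ne, ENNReal.ofReal_eq_zero, not_le]; positivity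
  have hR : ENNReal.ofReal (2^M) * (ENNReal.ofReal (((L:ℝ)^(d+1))⁻¹) * I1 d M) * κ =
      ENNReal.ofReal ((1/(4*L:ℝ))^(d+1)) * ((ENNReal.ofReal (2^M * 4^(d+1)) * I1 d M) * κ) := by
    rw [← mul_assoc (ENNReal.ofReal (2^M)), ← ENNReal.ofReal_mul (by positivity),
      ← mul_assoc (ENNReal.ofReal ((1/(4*L:ℝ))^(d+1))),
      ← mul_assoc (ENNReal.ofReal ((1/(4*L:ℝ))^(d+1))), ← ENNReal.ofReal_mul (by positivity)]
    congr 3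
    rw [div_pow, mul_pow, one_pow]; field_simp
  rw [hR, mul_assoc] at step3
  have step4 := (ENNReal.mul_le_mul_iff_right hA0 ENNReal.ofReal_ne_top).1 step3
  unfold KK
  rw [ENNReal.mul_div_right_comm.symm]
  rw [ENNReal.le_div_iff_mul_le (Or.inl (v1_pos d)) (Or.inl (v1_fin d)), mul_comm]
  exact step4

def nbS (d L : ℕ) : Set (Sph d × Esp d) := {q | ‖q.2 - (q.1 : Esp d)‖ < 1/(4*(L:ℝ))}

lemma nbS_meas (d L : ℕ) : MeasurableSet (nbS d L) := by
  have h : IsOpen (nbS d L) := by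
    unfold nbS
    exact isOpen_lt (continuous_snd.sub (continuous_subtype_val.comp continuous_fst)).norm
      continuous_const
  exact h.measurableSet

def Phi (d M L : ℕ) (w : Esp d) (q : Sph d × Esp d) : ℝ≥0∞ :=
  (nbS d L).indicator (fun q => ENNReal.ofReal (2^M) * ENNReal.ofReal (dk d M L q.2 w)) q

lemma dk_cont1 (d M L : ℕ) (w : Esp d) : Continuous fun x : Esp d => dk d M L x w := by
  unfold dk
  refine Continuous.inv₀ (by fun_prop) fun q => ?_
  positivity

lemma dk_meas (d M L : ℕ) (w : Esp d) :
    Measurable fun x : Esp d => ENNReal.ofReal (dk d M L x w) :=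
  ENNReal.measurable_ofReal.comp (dk_cont1 d M L w).measurable

lemma Phi_meas (d M L : ℕ) (w : Esp d) : Measurable (Phi d M L w) := by
  have h : Measurable fun q : Sph d × Esp d =>
      ENNReal.ofReal (2^M) * ENNReal.ofReal (dk d M L q.2 w) :=
    ((dk_meas d M L w).comp measurable_snd).const_mul _
  exact h.indicator (nbS_meas d L)

lemma Phi_step1 (d M L : ℕ) (hL : 1 ≤ L) (w : Esp d) (z : Sph d) :
    volume (Metric.ball (z : Esp d) (1/(4*(L:ℝ)))) *
      ENNReal.ofReal (dk d M L (z : Esp d) w) ≤ ∫⁻ x : Esp d, Phi d M L w (z, x) := by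
  have hLr : (1:ℝ) ≤ L := by exact_mod_cast hL
  have e : ∫⁻ x : Esp d, Phi d M L w (z, x) = ∫⁻ x in Metric.ball (z : Esp d) (1/(4*(L:ℝ))),
      ENNReal.ofReal (2^M) * ENNReal.ofReal (dk d M L x w) := by
    rw [← lintegral_indicator measurableSet_ball]
    congr 1
  rw [e, mul_comm, ← setLIntegral_const]
  refine setLIntegral_mono' measurableSet_ball fun x hx => ?_
  rw [← ENNReal.ofReal_mul (by positivity)]
  apply ENNReal.ofReal_le_ofReal
  rw [Metric.mem_ball, dist_eq_norm] at hx
  have h1 : 1 + L * ‖x - w‖ ≤ 2 * (1 + L * ‖(z:Esp d) - w‖) := by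
    have : ‖x - w‖ ≤ ‖x - z‖ + ‖(z:Esp d) - w‖ := norm_sub_le_norm_sub_add_norm_sub _ _ _
    have h2 : L * ‖x - z‖ ≤ 1/4 := by
      calc L * ‖x - z‖ ≤ L * (1/(4*(L:ℝ))) := by gcongr
        _ = 1/4 := by field_simp
    have h3 : 0 ≤ L * ‖(z:Esp d) - w‖ := by positivity
    nlinarith
  have h2 := pow_le_pow_left₀ (by positivity) h1 M
  rw [mul_pow] at h2
  unfold dk
  rw [← div_eq_mul_inv, le_div_iff₀ (by positivity), inv_mul_le_iff₀ (by positivity)]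
  linarith

lemma Phi_step2a (d M L : ℕ) (ν : Measure (Sph d)) (w x : Esp d) :
    ∫⁻ z, Phi d M L w (z, x) ∂ν = ENNReal.ofReal (2^M) * ENNReal.ofReal (dk d M L x w) *
        ν {z : Sph d | ‖x - (z : Esp d)‖ < 1/(4*(L:ℝ))} := by
  have hm : MeasurableSet {z : Sph d | ‖x - (z : Esp d)‖ < 1/(4*(L:ℝ))} :=
    (isOpen_lt (continuous_const.sub continuous_subtype_val).norm continuous_const).measurableSet
  rw [← setLIntegral_const, ← lintegral_indicator hm]
  congr 1

lemma Phi_step2 (d M L : ℕ) (hL : 1 ≤ L) (ν : Measure (Sph d)) [IsFiniteMeasure ν] (κ : ℝ≥0∞)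
    (hν : ∀ x : Esp d, ν {z : Sph d | ‖x - (z : Esp d)‖ < 1/(4*(L:ℝ))} ≤ κ) (w : Esp d) :
    ∫⁻ z, ∫⁻ x : Esp d, Phi d M L w (z, x) ∂volume ∂ν ≤ ENNReal.ofReal (2^M) *
      (ENNReal.ofReal (((L:ℝ)^(d+1))⁻¹) * I1 d M) * κ := by
  have hsw := lintegral_lintegral_swap (μ := ν) (ν := (volume : Measure (Esp d)))
    (f := fun z x => Phi d M L w (z, x)) (Phi_meas d M L w).aemeasurable
  rw [hsw, ← lint_dk d M L hL w,
    ← lintegral_const_mul _ (dk_meas d M L w),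
    ← lintegral_mul_const _ ((dk_meas d M L w).const_mul _)]
  refine lintegral_mono fun x => ?_
  rw [Phi_step2a]
  exact mul_le_mul' le_rfl (hν x)

lemma lint_nu (d M L : ℕ) (hL : 1 ≤ L) (ν : Measure (Sph d)) [IsFiniteMeasure ν] (κ : ℝ≥0∞)
    (hν : ∀ x : Esp d, ν {z : Sph d | ‖x - (z : Esp d)‖ < 1/(4*(L:ℝ))} ≤ κ) (w : Esp d) :
    ∫⁻ z : Sph d, ENNReal.ofReal (dk d M L (z : Esp d) w) ∂ν ≤ KK d M * κ := by
  have hLr : (1:ℝ) ≤ L := by exact_mod_cast hL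
  have step3 : ENNReal.ofReal ((1/(4*L:ℝ))^(d+1)) * volume (Metric.ball (0 : Esp d) 1) *
      ∫⁻ z : Sph d, ENNReal.ofReal (dk d M L (z : Esp d) w) ∂ν ≤ ENNReal.ofReal (2^M) *
      (ENNReal.ofReal (((L:ℝ)^(d+1))⁻¹) * I1 d M) * κ := by
    refine le_trans ?_ (Phi_step2 d M L hL ν κ hν w)
    have hmz : Measurable fun z : Sph d => ENNReal.ofReal (dk d M L (z : Esp d) w) :=
      (dk_meas d M L w).comp measurable_subtype_coe
    rw [← lintegral_const_mul _ hmz]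
    refine lintegral_mono fun z => ?_
    rw [← vol_ball d (z : Esp d) _ (by positivity)]
    exact Phi_step1 d M L hL w z
  exact lint_alg d M L hL κ _ step3

open scoped Pointwise in
lemma cap_upper (d L : ℕ) (hL : 1 ≤ L) (x : Esp d) :
    sphMeasure d {z : Sph d | ‖x - z‖ < 1/(4*L)} ≤
      ENNReal.ofReal ((d+1) * 2^(d+1) / L^d) * volume (Metric.ball (0 : Esp d) 1) := by
  have hLr : (1:ℝ) ≤ L := by exact_mod_cast hL
  have hm : MeasurableSet {z : Sph d | ‖x - z‖ < 1/(4*L)} :=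
    (isOpen_lt (by fun_prop) (by fun_prop)).measurableSet
  rcases Set.eq_empty_or_nonempty {z : Sph d | ‖x - z‖ < 1/(4*L)} with h | ⟨z, hz⟩
  · rw [h]; simp
  rw [sphMeasure, Measure.toSphere_apply' _ hm]
  have hsub : Set.Ioo (0:ℝ) 1 • (Subtype.val '' {z : Sph d | ‖x - z‖ < 1/(4*L)} : Set (Esp d)) ⊆
      ⋃ k ∈ Finset.range L, Metric.ball (((k:ℝ)/L) • (z : Esp d)) (2/L) := by
    rintro _ ⟨r, hr, _, ⟨w, hw, rfl⟩, rfl⟩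
    simp only [Set.mem_iUnion, Finset.mem_range]
    have hrL : 0 ≤ r * L := mul_nonneg hr.1.le (by positivity)
    refine ⟨⌊r * L⌋₊, ?_, ?_⟩
    · rw [Nat.floor_lt hrL]; nlinarith [hr.2]
    · have h1 := Nat.floor_le hrL
      have h2 := Nat.lt_floor_add_one (r * L)
      rw [Metric.mem_ball, dist_eq_norm]
      have hwz : ‖(w : Esp d) - z‖ < 1/L := by
        have hw' : ‖x - w‖ < 1/(4*L) := hw
        have hz' : ‖x - z‖ < 1/(4*L) := hz
        have : ‖(w : Esp d) - z‖ ≤ ‖(w : Esp d) - x‖ + ‖x - z‖ := norm_sub_le_norm_sub_add_norm_sub _ _ _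
        rw [norm_sub_rev (w : Esp d) x] at this
        have e : 1/(4*(L:ℝ)) = 1/L/4 := by field_simp
        have : 0 < 1/(L:ℝ) := by positivity
        rw [e] at hw' hz'
        linarith
      have hz1 := mem_sphere_zero_iff_norm.1 z.2
      have e : r • (w : Esp d) - ((⌊r * L⌋₊:ℝ)/L) • (z : Esp d) =
          r • ((w : Esp d) - z) + (r - (⌊r * L⌋₊:ℝ)/L) • (z : Esp d) := by
        rw [smul_sub, sub_smul]; abel
      rw [e]
      refine (norm_add_le _ _).trans_lt ?_
      rw [norm_smul, norm_smul, hz1, mul_one, Real.norm_of_nonneg hr.1.le]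
      have h3 : ‖r - (⌊r * L⌋₊:ℝ)/L‖ ≤ 1/L := by
        have : r - (⌊r * L⌋₊:ℝ)/L = (r * L - ⌊r * L⌋₊)/L := by field_simp
        rw [this, Real.norm_of_nonneg (by apply div_nonneg <;> linarith)]
        gcongr; linarith
      have h4 : r * ‖(w : Esp d) - z‖ ≤ ‖(w : Esp d) - z‖ :=
        mul_le_of_le_one_left (norm_nonneg _) hr.2.le
      have : (2:ℝ)/L = 1/L + 1/L := by ring
      linarith
  have hvol : volume (Set.Ioo (0:ℝ) 1 • (Subtype.val '' {z : Sph d | ‖x - z‖ < 1/(4*L)} : Set (Esp d)))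
      ≤ L * (ENNReal.ofReal ((2/L:ℝ)^(d+1)) * volume (Metric.ball (0 : Esp d) 1)) := by
    refine (measure_mono hsub).trans ((measure_biUnion_finset_le _ _).trans ?_)
    rw [Finset.sum_congr rfl fun k _ => vol_ball d _ _ (by positivity)]
    simp
  calc _ ≤ (Module.finrank ℝ (Esp d) : ℝ≥0∞) *
        (L * (ENNReal.ofReal ((2/L:ℝ)^(d+1)) * volume (Metric.ball (0 : Esp d) 1))) := by gcongr
    _ = _ := by
      rw [← mul_assoc, ← mul_assoc, ← ENNReal.ofReal_natCast, ← ENNReal.ofReal_natCast,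
        ← ENNReal.ofReal_mul (by positivity), ← ENNReal.ofReal_mul (by positivity)]
      congr 2
      simp
      rw [div_pow]; field_simp; ring

lemma gdist_le (d L : ℕ) (hL : 1 ≤ L) (z w : Sph d) (h : ‖(z : Esp d) - w‖ ≤ 1/(2*L)) :
    gdist d z w ≤ 1/L := by
  have hLr : (1:ℝ) ≤ L := by exact_mod_cast hL
  have hz := mem_sphere_zero_iff_norm.1 z.2
  have hw := mem_sphere_zero_iff_norm.1 w.2
  have hi := norm_sub_sq_real (z : Esp d) w
  rw [hz, hw] at hi
  have h1 : 1/(L:ℝ) ≤ 1 := by rw [div_le_one (by positivity)]; exact hLr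
  have h0 : 0 < 1/(L:ℝ) := by positivity
  have hpi := Real.pi_gt_three
  have hpi4 := Real.pi_le_four
  have hc := Real.cos_le_one_sub_mul_cos_sq (x := 1/(L:ℝ)) (by rw [abs_of_pos h0]; linarith)
  have h3 : (1:ℝ)/8 ≤ 2 / Real.pi ^ 2 := by
    rw [div_le_div_iff₀ (by norm_num) (by positivity)]; nlinarith
  have h4 : ‖(z : Esp d) - w‖ ^ 2 ≤ (1/L)^2/4 := by
    calc ‖(z : Esp d) - w‖ ^ 2 ≤ (1/(2*L))^2 := by gcongr
      _ = _ := by field_simp; norm_num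
  have h5 : 1/8 * (1/(L:ℝ))^2 ≤ 2 / Real.pi ^ 2 * (1/(L:ℝ))^2 := by gcongr
  have h6 : Real.cos (1/L) ≤ ⟪(z : Esp d), (w : Esp d)⟫ := by linarith
  unfold gdist
  calc _ ≤ Real.arccos (Real.cos (1/L)) := Real.arccos_le_arccos h6
    _ = 1/L := Real.arccos_cos h0.le (by linarith)

lemma young (d : ℕ) (F h : Sph d → ℝ) (hF : Continuous F) (hh : Continuous h) (hF0 : ∀ x, 0 ≤ F x)
    (hh0 : ∀ x, 0 ≤ h x) (q B H p : ℝ) (hp : 1 ≤ p) (hq : 0 ≤ q) (hB : 0 < B) (hH : 0 < H)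
    (h1 : q ≤ B * ∫ x, F x * h x ∂(sphMeasure d)) (h2 : ∫ x, h x ∂(sphMeasure d) ≤ H) :
    q ^ p ≤ 2 * B * (2 * B * H) ^ (p-1) * ∫ x, F x ^ p * h x ∂(sphMeasure d) := by
  have hJ : 0 ≤ ∫ x, F x ^ p * h x ∂(sphMeasure d) :=
    integral_nonneg fun x => mul_nonneg (Real.rpow_nonneg (hF0 x) _) (hh0 x)
  rcases hq.eq_or_lt with rfl | hq
  · rw [Real.zero_rpow (by linarith)]; positivity
  set l := q / (2 * B * H) with hl
  have hl0 : 0 < l := by positivity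
  have hFp : Continuous fun x => F x ^ p := hF.rpow_const fun x => Or.inr (by linarith)
  have hpt : ∀ x, F x ≤ l + l ^ (1-p) * F x ^ p := by
    intro x
    have hx := hF0 x
    rcases le_total (F x) l with hle | hle
    · have : 0 ≤ l ^ (1-p) * F x ^ p := by positivity
      linarith
    · have hx0 : 0 < F x := hl0.trans_le hle
      have e : F x = F x ^ (1-p) * F x ^ p := by
        rw [← Real.rpow_add hx0]; simp
      have : F x ^ (1-p) ≤ l ^ (1-p) := Real.rpow_le_rpow_of_nonpos hl0 hle (by linarith)
      calc F x = F x ^ (1-p) * F x ^ p := e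
        _ ≤ l ^ (1-p) * F x ^ p := by gcongr
        _ ≤ _ := by linarith
  set J := ∫ x, F x ^ p * h x ∂(sphMeasure d) with hJd
  have hI : ∫ x, F x * h x ∂(sphMeasure d) ≤ l * H + l ^ (1-p) * J := by
    calc ∫ x, F x * h x ∂(sphMeasure d)
        ≤ ∫ x, (l * h x + l ^ (1-p) * (F x ^ p * h x)) ∂(sphMeasure d) := by
          refine integral_mono (cont_int d (by fun_prop)) (cont_int d (by fun_prop)) fun x => ?_
          simp only
          calc F x * h x ≤ (l + l ^ (1-p) * F x ^ p) * h x :=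
                mul_le_mul_of_nonneg_right (hpt x) (hh0 x)
            _ = _ := by ring
      _ = l * ∫ x, h x ∂(sphMeasure d) + l ^ (1-p) * J := by
          rw [integral_add (cont_int d (by fun_prop)) (cont_int d (by fun_prop)),
            integral_const_mul, integral_const_mul]
      _ ≤ _ := by gcongr
  have h3 : q ≤ 2 * B * (l ^ (1-p) * J) := by
    have e : B * (l * H) = q / 2 := by rw [hl]; field_simp
    have : B * ∫ x, F x * h x ∂(sphMeasure d) ≤ B * (l * H + l ^ (1-p) * J) := by gcongr
    nlinarith
  have e1 : q ^ p = q * q ^ (p-1) := by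
    rw [← Real.rpow_one_add' hq.le (by linarith)]; congr 1; ring
  have e2 : l ^ (1-p) * q ^ (p-1) = (2 * B * H) ^ (p-1) := by
    have : l ^ (1-p) = (l⁻¹) ^ (p-1) := by
      rw [Real.inv_rpow hl0.le, ← Real.rpow_neg hl0.le]; congr 1; ring
    rw [this, ← Real.mul_rpow (by positivity) hq.le]
    congr 1
    rw [hl]; field_simp
  calc q ^ p = q * q ^ (p-1) := e1
    _ ≤ (2 * B * (l ^ (1-p) * J)) * q ^ (p-1) := by gcongr
    _ = 2 * B * (l ^ (1-p) * q ^ (p-1)) * J := by ring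
    _ = _ := by rw [e2]


lemma dk_symm (d M L : ℕ) (x w : Esp d) : dk d M L x w = dk d M L w x := by
  unfold dk; rw [norm_sub_rev]

lemma dk_contS (d M L : ℕ) (w : Esp d) : Continuous fun z : Sph d => dk d M L (z : Esp d) w :=
  (dk_cont1 d M L w).comp continuous_subtype_val

lemma dk_contS' (d M L : ℕ) (z : Esp d) : Continuous fun w : Sph d => dk d M L z (w : Esp d) := by
  have := dk_contS d M L z
  simp_rw [dk_symm d M L z]
  exact this

lemma sph_real_pos (d : ℕ) : 0 < (sphMeasure d).real Set.univ := by
  have : Nonempty (Sph d) := ⟨north d⟩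
  exact ENNReal.toReal_pos (isOpen_univ.measure_pos _ Set.univ_nonempty).ne' (measure_ne_top _ _)

lemma ptwise (d : ℕ) : ∃ a : ℝ, 0 < a ∧ ∀ L : ℕ, 1 ≤ L → ∀ Q ∈ PiSp d L, ∀ z : Sph d,
    |Q z| ≤ a * (L:ℝ)^d * ∫ w : Sph d, |Q w| * dk d (2*(d+1)) L (z : Esp d) (w : Esp d)
      ∂(sphMeasure d) := by
  have hS := sph_real_pos d
  set S := (sphMeasure d).real Set.univ with hSdef
  refine ⟨2 * ((d:ℝ)+3)^d * 10^(d+1) / S, by positivity, fun L hL Q hQ z => ?_⟩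
  have hLr : (1:ℝ) ≤ L := by exact_mod_cast hL
  rw [PiSp_eq] at hQ
  obtain ⟨G, hG1, hG2, hG3⟩ := exists_kernel (d+1) L hL
  have hg := polyW_poly d (polyW_lin d (fun i => (z : Esp d) i)) G hG1
  have hfg := polyW_mul d hQ hg
  have hn := nikolskii1 d _ _ hfg z
  have hzz : ∑ i, (z : Esp d) i * (z : Esp d) i = 1 := by
    rw [← sph_sum_sq d z]; exact Finset.sum_congr rfl fun i _ => by ring
  have hb : ∀ w : Sph d, |G.eval (∑ i, (z : Esp d) i * (w : Esp d) i)| ≤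
      10^(d+1) * dk d (2*(d+1)) L (z : Esp d) (w : Esp d) := by
    intro w
    have hin : ∑ i, (z : Esp d) i * (w : Esp d) i = ⟪(z : Esp d), (w : Esp d)⟫ := by
      rw [PiLp.inner_apply]; exact Finset.sum_congr rfl fun i _ => by simp [mul_comm]
    have hz := mem_sphere_zero_iff_norm.1 z.2
    have hw := mem_sphere_zero_iff_norm.1 w.2
    apply hG3
    · rw [hin]
      have := abs_real_inner_le_norm (z : Esp d) (w : Esp d)
      rwa [hz, hw, one_mul] at this
    · exact norm_nonneg _
    · rw [hin, norm_sub_sq_real, hz, hw]; ring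
  have hQc := polyW_cont d L hQ
  have hgc := polyW_cont d _ hg
  have hi : ∫ x, |(Q * fun x : Sph d => G.eval (∑ i, (z : Esp d) i * (x : Esp d) i)) x|
      ∂(sphMeasure d) ≤ 10^(d+1) * ∫ w : Sph d, |Q w| * dk d (2*(d+1)) L (z : Esp d) (w : Esp d)
      ∂(sphMeasure d) := by
    rw [← integral_const_mul]
    apply integral_mono
    · exact cont_int d (hQc.mul hgc).abs
    · exact cont_int d (continuous_const.mul (hQc.abs.mul (dk_contS' d _ L z)))
    · intro w
      simp only [Pi.mul_apply, abs_mul]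
      calc _ ≤ |Q w| * (10^(d+1) * dk d (2*(d+1)) L (z : Esp d) (w : Esp d)) :=
            mul_le_mul_of_nonneg_left (hb w) (abs_nonneg _)
        _ = _ := by ring
  have hdim : (Module.finrank ℝ (polyW d (L + (d+1)*L)) : ℝ) ≤ 2 * ((d:ℝ)+3)^d * L^d := by
    have h1 : (Module.finrank ℝ (polyW d (L + (d+1)*L)) : ℝ) ≤ 2 * (((L + (d+1)*L : ℕ):ℝ)+1)^d := by
      exact_mod_cast dim_upper d (L + (d+1)*L)
    refine h1.trans ?_
    rw [mul_assoc, ← mul_pow]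
    push_cast
    gcongr
    nlinarith
  have hJ : 0 ≤ ∫ w : Sph d, |Q w| * dk d (2*(d+1)) L (z : Esp d) (w : Esp d)
      ∂(sphMeasure d) := integral_nonneg fun w => mul_nonneg (abs_nonneg _) (dk_nonneg _ _ _ _ _)
  set J := ∫ w : Sph d, |Q w| * dk d (2*(d+1)) L (z : Esp d) (w : Esp d) ∂(sphMeasure d) with hJd
  have hz1 : (Q * fun x : Sph d => G.eval (∑ i, (z : Esp d) i * (x : Esp d) i)) z = Q z := by
    simp only [Pi.mul_apply]; rw [hzz, hG2, mul_one]
  rw [hz1] at hn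
  have h3 : S * |Q z| ≤ (2 * ((d:ℝ)+3)^d * L^d) * (10^(d+1) * J) :=
    hn.trans (mul_le_mul hdim hi (integral_nonneg fun _ => abs_nonneg _) (by positivity))
  have : |Q z| ≤ ((2 * ((d:ℝ)+3)^d * L^d) * (10^(d+1) * J)) / S := by
    rw [le_div_iff₀ hS]; linarith
  refine this.trans (le_of_eq ?_)
  ring

lemma dk_int (d : ℕ) : ∃ η : ℝ, 0 < η ∧ ∀ L : ℕ, 1 ≤ L → ∀ z : Sph d,
    ∫ w : Sph d, dk d (2*(d+1)) L (z : Esp d) (w : Esp d) ∂(sphMeasure d) ≤ η / (L:ℝ)^d := by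
  have hK := KK_lt d (2*(d+1)) (by omega)
  set k := (KK d (2*(d+1))).toReal * (((d:ℝ)+1) * 2^(d+1) *
    (volume (Metric.ball (0 : Esp d) 1)).toReal) with hk
  have hk0 : 0 ≤ k := by positivity
  refine ⟨k + 1, by positivity, fun L hL z => ?_⟩
  have hLr : (1:ℝ) ≤ L := by exact_mod_cast hL
  have h := lint_nu d (2*(d+1)) L hL (sphMeasure d) _ (fun x => cap_upper d L hL x) (z : Esp d)
  have he : ∫ w : Sph d, dk d (2*(d+1)) L (z : Esp d) (w : Esp d) ∂(sphMeasure d) =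
      (∫⁻ w : Sph d, ENNReal.ofReal (dk d (2*(d+1)) L (w : Esp d) (z : Esp d)) ∂(sphMeasure d)).toReal := by
    simp_rw [dk_symm d (2*(d+1)) L (z : Esp d)]
    exact integral_eq_lintegral_of_nonneg_ae (Filter.Eventually.of_forall fun w => dk_nonneg _ _ _ _ _)
      (dk_contS d _ L z).aestronglyMeasurable
  rw [he]
  have h2 := ENNReal.toReal_mono (ENNReal.mul_ne_top hK
    (ENNReal.mul_ne_top ENNReal.ofReal_ne_top (v1_fin d))) h
  refine h2.trans ?_
  rw [ENNReal.toReal_mul, ENNReal.toReal_mul, ENNReal.toReal_ofReal (by positivity)]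
  have : (KK d (2*(d+1))).toReal * (((d:ℝ)+1) * 2^(d+1) / L^d *
    (volume (Metric.ball (0 : Esp d) 1)).toReal) = k / L^d := by rw [hk]; ring
  rw [this]
  gcongr; linarith

lemma ptwise_p (d : ℕ) (p : ℝ) (hp : 1 ≤ p) : ∃ c : ℝ, 0 < c ∧ ∀ L : ℕ, 1 ≤ L → ∀ Q ∈ PiSp d L,
    ∀ z : Sph d, |Q z| ^ p ≤ c * (L:ℝ)^d *
      ∫ w : Sph d, |Q w| ^ p * dk d (2*(d+1)) L (z : Esp d) (w : Esp d) ∂(sphMeasure d) := by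
  obtain ⟨a, ha, h1⟩ := ptwise d
  obtain ⟨η, hη, h2⟩ := dk_int d
  refine ⟨2 * a * (2 * a * η)^(p-1), by positivity, fun L hL Q hQ z => ?_⟩
  have hLr : (1:ℝ) ≤ L := by exact_mod_cast hL
  have hQc : Continuous Q := polyW_cont d L (by rwa [PiSp_eq] at hQ)
  have := young d (fun w => |Q w|) (fun w => dk d (2*(d+1)) L (z : Esp d) (w : Esp d)) hQc.abs
    (dk_contS' d _ L z) (fun _ => abs_nonneg _) (fun _ => dk_nonneg _ _ _ _ _) |Q z| (a * (L:ℝ)^d)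
    (η / (L:ℝ)^d) p hp (abs_nonneg _) (by positivity) (by positivity) (h1 L hL Q hQ z) (h2 L hL z)
  refine this.trans (le_of_eq ?_)
  have e : 2 * (a * (L:ℝ)^d) * (η / (L:ℝ)^d) = 2 * a * η := by field_simp
  rw [e]; ring

lemma mu_ball (d L : ℕ) (hL : 1 ≤ L) (ν : Measure (Sph d)) (κ : ℝ≥0∞)
    (h : ∀ z : Sph d, ν {w : Sph d | gdist d z w ≤ 1 / L} ≤ κ) (x : Esp d) :
    ν {z : Sph d | ‖x - (z : Esp d)‖ < 1/(4*(L:ℝ))} ≤ κ := by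
  have hLr : (1:ℝ) ≤ L := by exact_mod_cast hL
  rcases Set.eq_empty_or_nonempty {z : Sph d | ‖x - (z : Esp d)‖ < 1/(4*(L:ℝ))} with h0 | ⟨z, hz⟩
  · rw [h0]; simp
  refine (measure_mono fun w hw => ?_).trans (h z)
  simp only [Set.mem_ofPred_eq] at hw hz ⊢
  apply gdist_le d L hL
  have h3 : ‖(z : Esp d) - w‖ ≤ ‖(z : Esp d) - x‖ + ‖x - (w : Esp d)‖ :=
    norm_sub_le_norm_sub_add_norm_sub _ _ _
  rw [norm_sub_rev (z : Esp d) x] at h3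
  have : 1/(4*(L:ℝ)) + 1/(4*(L:ℝ)) = 1/(2*L) := by field_simp; norm_num
  linarith

lemma mu_fin (d L : ℕ) (hL : 1 ≤ L) (ν : Measure (Sph d)) (κ : ℝ≥0∞) (hκ : κ ≠ ∞)
    (h : ∀ z : Sph d, ν {w : Sph d | gdist d z w ≤ 1 / L} ≤ κ) : IsFiniteMeasure ν := by
  have hLr : (1:ℝ) ≤ L := by exact_mod_cast hL
  have : IsLocallyFiniteMeasure ν := ⟨fun z => by
    refine ⟨{w : Sph d | ‖(z : Esp d) - (w : Esp d)‖ < 1/(4*(L:ℝ))}, ?_,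
      (mu_ball d L hL ν κ h z).trans_lt (lt_top_iff_ne_top.2 hκ)⟩
    have ho : IsOpen {w : Sph d | ‖(z : Esp d) - (w : Esp d)‖ < 1/(4*(L:ℝ))} :=
      isOpen_lt (continuous_const.sub continuous_subtype_val).norm continuous_const
    refine ho.mem_nhds ?_
    simp only [Set.mem_ofPred_eq, sub_self, norm_zero]; positivity⟩
  infer_instance

lemma carl_lint (d L : ℕ) (ν : Measure (Sph d)) [IsFiniteMeasure ν] (f : Sph d → ℝ)
    (hf : Continuous f) (hf0 : ∀ x, 0 ≤ f x) (c : ℝ) (hc : 0 ≤ c) (M : ℕ)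
    (h : ∀ z : Sph d, f z ≤ c *
      ∫ w : Sph d, f w * dk d M L (z : Esp d) (w : Esp d) ∂(sphMeasure d))
    (R : ℝ≥0∞) (hR : ∀ w : Sph d, ∫⁻ z : Sph d, ENNReal.ofReal (dk d M L (z : Esp d) (w : Esp d)) ∂ν ≤ R) :
    ∫⁻ z, ENNReal.ofReal (f z) ∂ν ≤ ENNReal.ofReal c * R *
      ∫⁻ w, ENNReal.ofReal (f w) ∂(sphMeasure d) := by
  have hfm : Measurable fun w => ENNReal.ofReal (f w) := ENNReal.measurable_ofReal.comp hf.measurable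
  have hkm : Measurable fun q : Sph d × Sph d =>
      ENNReal.ofReal (dk d M L (q.1 : Esp d) (q.2 : Esp d)) := by
    apply ENNReal.measurable_ofReal.comp
    have : Continuous fun q : Sph d × Sph d => dk d M L (q.1 : Esp d) (q.2 : Esp d) := by
      unfold dk
      refine Continuous.inv₀ (by fun_prop) fun q => ?_
      positivity
    exact this.measurable
  have hjm : Measurable fun q : Sph d × Sph d => ENNReal.ofReal (f q.2) *
      ENNReal.ofReal (dk d M L (q.1 : Esp d) (q.2 : Esp d)) := (hfm.comp measurable_snd).mul hkm
  have h1 : ∀ z : Sph d, ENNReal.ofReal (f z) ≤ ENNReal.ofReal c * ∫⁻ w : Sph d,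
      ENNReal.ofReal (f w) * ENNReal.ofReal (dk d M L (z : Esp d) (w : Esp d)) ∂(sphMeasure d) := by
    intro z
    refine (ENNReal.ofReal_le_ofReal (h z)).trans ?_
    have hci : Continuous fun w : Sph d => f w * dk d M L (z : Esp d) (w : Esp d) :=
      hf.mul (dk_contS' d M L z)
    rw [ENNReal.ofReal_mul hc, ofReal_integral_eq_lintegral_ofReal (cont_int d hci)
      (Filter.Eventually.of_forall fun w => mul_nonneg (hf0 w) (dk_nonneg _ _ _ _ _))]
    refine mul_le_mul' le_rfl (lintegral_mono fun w => ?_)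
    rw [ENNReal.ofReal_mul (hf0 w)]
  refine (lintegral_mono h1).trans ?_
  have hm2 : Measurable fun z : Sph d => ∫⁻ w : Sph d,
      ENNReal.ofReal (f w) * ENNReal.ofReal (dk d M L (z : Esp d) (w : Esp d)) ∂(sphMeasure d) :=
    hjm.lintegral_prod_right'
  rw [lintegral_const_mul _ hm2, mul_assoc]
  refine mul_le_mul' le_rfl ?_
  have hsw := lintegral_lintegral_swap (μ := ν) (ν := sphMeasure d)
    (f := fun z w => ENNReal.ofReal (f w) * ENNReal.ofReal (dk d M L (z : Esp d) (w : Esp d)))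
    hjm.aemeasurable
  rw [hsw, ← lintegral_const_mul _ hfm]
  refine lintegral_mono fun w => ?_
  have hmz : Measurable fun z : Sph d => ENNReal.ofReal (dk d M L (z : Esp d) (w : Esp d)) :=
    (dk_meas d M L w).comp measurable_subtype_coe
  rw [lintegral_const_mul _ hmz, mul_comm]
  exact mul_le_mul' (hR w) le_rfl

lemma pi_lower (d L : ℕ) (hd : 1 ≤ d) (C : ℝ) (hC : 0 < C) (hL : 1 ≤ L) :
    (L:ℝ)^d * (C / (Module.finrank ℝ (PiSp d L) : ℝ)) ≤ C * (d:ℝ)^d := by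
  have hdr : (1:ℝ) ≤ d := by exact_mod_cast hd
  have h1 : (((L/d : ℕ):ℝ) + 1)^d ≤ (Module.finrank ℝ (PiSp d L) : ℝ) := by
    exact_mod_cast dim_lower d L
  have h2 : (L:ℝ) ≤ d * (((L/d : ℕ):ℝ) + 1) := by
    have := Nat.lt_mul_div_succ L (show 0 < d by omega)
    exact_mod_cast this.le
  have h3 : (L:ℝ)^d ≤ (d:ℝ)^d * (Module.finrank ℝ (PiSp d L) : ℝ) := by
    calc (L:ℝ)^d ≤ (d * (((L/d : ℕ):ℝ) + 1))^d := by gcongr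
      _ = (d:ℝ)^d * (((L/d : ℕ):ℝ) + 1)^d := mul_pow _ _ _
      _ ≤ _ := by gcongr
  have hpos : 0 < (Module.finrank ℝ (PiSp d L) : ℝ) := lt_of_lt_of_le (by positivity) h1
  rw [mul_div_assoc', div_le_iff₀ hpos]
  nlinarith

/-- Sufficiency in the Carleson-family characterization: if
`sup_z μ_L(B(z,1/L)) ≤ C/π_L` for all `L ≥ 1` (geodesic balls), then
`∫ |Q|^p dμ_L ≤ C' ∫ |Q|^p dσ` for all `Q ∈ Π_L`. -/
theorem stmt15 (d : ℕ) (hd : 1 ≤ d) (p : ℝ) (hp : 1 ≤ p)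
    (μ : ℕ → Measure (Sph d)) (C : ℝ) (hC : 0 < C)
    (hμ : ∀ L : ℕ, 1 ≤ L → ∀ z : Sph d,
      μ L {w : Sph d | gdist d z w ≤ 1 / L}
        ≤ ENNReal.ofReal (C / (Module.finrank ℝ (PiSp d L) : ℝ))) :
    ∃ C' : ℝ, 0 < C' ∧ ∀ L : ℕ, 1 ≤ L → ∀ Q ∈ PiSp d L,
      ∫ z, |Q z| ^ p ∂(μ L) ≤ C' * ∫ z, |Q z| ^ p ∂(sphMeasure d) := by
  obtain ⟨c, hc, hpt⟩ := ptwise_p d p hp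
  have hK := KK_lt d (2*(d+1)) (by omega)
  have hdr : (1:ℝ) ≤ d := by exact_mod_cast hd
  refine ⟨c * (KK d (2*(d+1))).toReal * (C * (d:ℝ)^d) + 1, by positivity, fun L hL Q hQ => ?_⟩
  have hLr : (1:ℝ) ≤ L := by exact_mod_cast hL
  have hfin := mu_fin d L hL (μ L) _ ENNReal.ofReal_ne_top (hμ L hL)
  have hQc : Continuous Q := polyW_cont d L (by rwa [PiSp_eq] at hQ)
  have hfc : Continuous fun z => |Q z| ^ p := hQc.abs.rpow_const fun _ => Or.inr (by linarith)
  have hf0 : ∀ z, 0 ≤ |Q z| ^ p := fun z => Real.rpow_nonneg (abs_nonneg _) _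
  have hmain := carl_lint d L (μ L) (fun z => |Q z| ^ p) hfc hf0 (c * (L:ℝ)^d) (by positivity)
    (2*(d+1)) (hpt L hL Q hQ) _
    (fun w => lint_nu d (2*(d+1)) L hL (μ L) _ (mu_ball d L hL (μ L) _ (hμ L hL)) (w : Esp d))
  have e1 := integral_eq_lintegral_of_nonneg_ae (μ := μ L) (Filter.Eventually.of_forall hf0)
    hfc.aestronglyMeasurable
  have e2 := ofReal_integral_eq_lintegral_ofReal (cont_int d hfc) (Filter.Eventually.of_forall hf0)
  rw [← e2] at hmain
  have hJ : 0 ≤ ∫ z, |Q z| ^ p ∂(sphMeasure d) := integral_nonneg hf0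
  have h2 := ENNReal.toReal_mono (ENNReal.mul_ne_top (ENNReal.mul_ne_top ENNReal.ofReal_ne_top
    (ENNReal.mul_ne_top hK ENNReal.ofReal_ne_top)) ENNReal.ofReal_ne_top) hmain
  rw [← e1, ENNReal.toReal_mul, ENNReal.toReal_mul, ENNReal.toReal_mul,
    ENNReal.toReal_ofReal (by positivity), ENNReal.toReal_ofReal (by positivity),
    ENNReal.toReal_ofReal hJ] at h2
  refine h2.trans (mul_le_mul_of_nonneg_right ?_ hJ)
  have h3 := pi_lower d L hd C hC hL
  have hk0 : 0 ≤ c * (KK d (2*(d+1))).toReal := by positivity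
  have h4 := mul_le_mul_of_nonneg_left h3 hk0
  calc _ = c * (KK d (2*(d+1))).toReal * ((L:ℝ)^d * (C / (Module.finrank ℝ (PiSp d L) : ℝ))) := by
        ring
    _ ≤ _ := by linarith

end
end

section
/- (Bernstein-type gradient bound) There is a constant C depending only on d, p, ε such that for every L ≥ 1, every Q ∈ Π_L extended harmonically to R^{d+1}, and every x ∈ R^{d+1} with | |x| − 1 | ≤ ε/(4L): |∇Q(x)|^p ≤ C · L^{d+p+1} · ∫_{𝔹(x, ε/(2L))} |Q(v)|^p dm(v), where 𝔹 denotes a Euclidean ball in R^{d+1} and m is Lebesgue measure. -/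
open MeasureTheory MvPolynomial
open scoped RealInnerProductSpace ENNReal

noncomputable section

namespace Bern

def ev (d : ℕ) (P : MvPolynomial (Fin (d+1)) ℝ) (v : Esp d) : ℝ := eval (fun j => v j) P

lemma ev_cont (d : ℕ) (P : MvPolynomial (Fin (d+1)) ℝ) : Continuous (ev d P) := by
  unfold ev
  exact (MvPolynomial.continuous_eval P).comp (by fun_prop)

lemma ev_fderiv (d : ℕ) (P : MvPolynomial (Fin (d+1)) ℝ) (v : Esp d) :
    HasFDerivAt (ev d P)
      (∑ i, ev d (pderiv i P) v • (EuclideanSpace.proj i : Esp d →L[ℝ] ℝ)) v := by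
  induction P using MvPolynomial.induction_on with
  | C a =>
    have h : ev d (C a) = fun _ => a := by ext; simp [ev]
    rw [h]
    refine (hasFDerivAt_const a v).congr_fderiv ?_
    simp [ev]
  | add p q hp hq =>
    have := hp.add hq
    refine (this.congr_fderiv ?_).congr_of_eventuallyEq ?_
    · simp [ev, add_smul, Finset.sum_add_distrib]
    · exact Filter.Eventually.of_forall fun x => by simp [ev]
  | mul_X p j hp =>
    have hX : HasFDerivAt (fun v : Esp d => v j) (EuclideanSpace.proj j : Esp d →L[ℝ] ℝ) v :=
      (EuclideanSpace.proj j : Esp d →L[ℝ] ℝ).hasFDerivAt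
    have := hp.mul hX
    refine (this.congr_fderiv ?_).congr_of_eventuallyEq ?_
    · ext u
      simp [ev, pderiv_mul, pderiv_X, add_mul, Finset.sum_add_distrib, Finset.mul_sum, Pi.single_apply]
      congr 1
      · rw [Finset.sum_eq_single j]
        · simp
        · intro b _ hb
          simp [hb.symm]
        · simp
      · apply Finset.sum_congr rfl; intros; ring
    · exact Filter.Eventually.of_forall fun x => by simp [ev]

lemma pderiv_comm (d : ℕ) (i j : Fin (d+1)) (P : MvPolynomial (Fin (d+1)) ℝ) :
    pderiv i (pderiv j P) = pderiv j (pderiv i P) := by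
  have : ⁅(pderiv i : Derivation ℝ (MvPolynomial (Fin (d+1)) ℝ) (MvPolynomial (Fin (d+1)) ℝ)),
      (pderiv j : Derivation ℝ (MvPolynomial (Fin (d+1)) ℝ) (MvPolynomial (Fin (d+1)) ℝ))⁆ = 0 := by
    apply derivation_ext
    intro k
    rw [Derivation.commutator_apply]
    simp [pderiv_X, Pi.single_apply]
    split_ifs <;> simp
  have h := congrArg (fun D => D P) this
  simp only [Derivation.commutator_apply] at h
  exact sub_eq_zero.1 h

lemma lap_mem (d L : ℕ) (P : MvPolynomial (Fin (d+1)) ℝ) (hP : P ∈ harmPolyLe d L) :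
    ∑ i, pderiv i (pderiv i P) = 0 := by
  have : harmPolyLe d L ≤ LinearMap.ker (polyLap d) := iSup_le fun _ => inf_le_right
  have := this hP
  simpa [polyLap] using this

lemma lap_pderiv (d : ℕ) (P : MvPolynomial (Fin (d+1)) ℝ)
    (hP : ∑ i, pderiv i (pderiv i P) = 0) (k : Fin (d+1)) :
    ∑ i, pderiv i (pderiv i (pderiv k P)) = 0 := by
  have := congrArg (pderiv k) hP
  simpa [pderiv_comm d _ k] using this

lemma ev_line (d : ℕ) (P : MvPolynomial (Fin (d+1)) ℝ) (x : Esp d) (r : ℝ) (u : Esp d) :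
    HasFDerivAt (fun u => ev d P (x + r • u))
      (r • ∑ i, ev d (pderiv i P) (x + r • u) • (EuclideanSpace.proj i : Esp d →L[ℝ] ℝ)) u := by
  have h1 : HasFDerivAt (fun u : Esp d => x + r • u) (r • ContinuousLinearMap.id ℝ (Esp d)) u :=
    ((hasFDerivAt_id u).const_smul r).const_add x
  refine ((ev_fderiv d P (x + r • u)).comp u h1).congr_fderiv ?_
  ext w
  simp [Finset.mul_sum]

lemma cs_int {d : ℕ} {f g : Esp d → ℝ} (hf : Continuous f) (hc : HasCompactSupport f)
    (hg : Continuous g) : Integrable (fun u => f u * g u) :=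
  (hf.mul hg).integrable_of_hasCompactSupport hc.mul_right

lemma ibp (d : ℕ) (P : MvPolynomial (Fin (d+1)) ℝ) (x : Esp d) (r : ℝ) (i : Fin (d+1))
    (f : Esp d → ℝ) (hf : ContDiff ℝ 1 f) (hc : HasCompactSupport f) :
    r * ∫ u, f u * ev d (pderiv i P) (x + r • u) =
      - ∫ u, fderiv ℝ f u (EuclideanSpace.single i 1) * ev d P (x + r • u) := by
  have hfd : ∀ u, fderiv ℝ (fun u => ev d P (x + r • u)) u (EuclideanSpace.single i 1) =
      r * ev d (pderiv i P) (x + r • u) := by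
    intro u
    rw [(ev_line d P x r u).fderiv]
    simp [PiLp.single_apply]
  have hg : ∀ Q : MvPolynomial (Fin (d+1)) ℝ, Continuous fun u => ev d Q (x + r • u) := fun Q =>
    (ev_cont d Q).comp (by fun_prop)
  have := integral_mul_fderiv_eq_neg_fderiv_mul_of_integrable (μ := (volume : Measure (Esp d)))
    (f := f) (g := fun u => ev d P (x + r • u))
    (v := EuclideanSpace.single i 1)
    (cs_int ((hf.continuous_fderiv (by simp)).clm_apply continuous_const) (hc.fderiv_apply ℝ _) (hg P))
    (by simp only [hfd]; exact cs_int hf.continuous hc ((hg _).const_mul r))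
    (cs_int hf.continuous hc (hg _))
    (fun x _ => (hf.differentiable (by simp)).differentiableAt)
    (fun u _ => (ev_line d P x r u).differentiableAt)
  rw [← this, ← integral_const_mul]
  congr 1; ext u; rw [hfd]; ring

/-- weight -/
def g (s : ℝ) : ℝ := Real.smoothTransition (1 - s)
def G (s : ℝ) : ℝ := ∫ t in (1:ℝ)..s, g t
def w (d : ℕ) (u : Esp d) : ℝ := g (‖u‖ ^ 2)
def Psi (d : ℕ) (u : Esp d) : ℝ := G (‖u‖ ^ 2)

lemma g_cd : ContDiff ℝ 1 g := by
  unfold g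
  exact (Real.smoothTransition.contDiff (n := 1)).comp (contDiff_const.sub contDiff_id)

lemma g_zero {s : ℝ} (h : 1 ≤ s) : g s = 0 := Real.smoothTransition.zero_of_nonpos (by linarith)

lemma G_deriv (s : ℝ) : HasDerivAt G (g s) s :=
  intervalIntegral.integral_hasDerivAt_right (g_cd.continuous.intervalIntegrable _ _)
    (g_cd.continuous.stronglyMeasurableAtFilter _ _) g_cd.continuous.continuousAt

lemma G_cd : ContDiff ℝ 1 G := by
  rw [contDiff_one_iff_deriv]
  refine ⟨fun s => (G_deriv s).differentiableAt, ?_⟩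
  have : deriv G = g := funext fun s => (G_deriv s).deriv
  rw [this]; exact g_cd.continuous

lemma G_zero {s : ℝ} (h : 1 ≤ s) : G s = 0 := by
  unfold G
  rw [intervalIntegral.integral_congr (g := fun _ => 0)]
  · simp
  · intro t ht
    rw [Set.uIcc_of_le h] at ht
    exact g_zero ht.1

lemma w_cd (d : ℕ) : ContDiff ℝ 1 (w d) := g_cd.comp (contDiff_norm_sq ℝ)
lemma Psi_cd (d : ℕ) : ContDiff ℝ 1 (Psi d) := G_cd.comp (contDiff_norm_sq ℝ)

lemma one_le_sq {d : ℕ} {u : Esp d} (h : 1 ≤ ‖u‖) : 1 ≤ ‖u‖^2 := by nlinarith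

lemma w_cs (d : ℕ) : HasCompactSupport (w d) :=
  HasCompactSupport.intro (isCompact_closedBall (0 : Esp d) 1) fun u hu =>
    g_zero (one_le_sq (by simp at hu; exact hu.le))

lemma Psi_cs (d : ℕ) : HasCompactSupport (Psi d) :=
  HasCompactSupport.intro (isCompact_closedBall (0 : Esp d) 1) fun u hu =>
    G_zero (one_le_sq (by simp at hu; exact hu.le))

lemma Psi_fderiv (d : ℕ) (u : Esp d) (i : Fin (d+1)) :
    fderiv ℝ (Psi d) u (EuclideanSpace.single i 1) = 2 * (w d u * u i) := by
  have h : HasFDerivAt (fun u : Esp d => ‖u‖ ^ 2) (2 • innerSL ℝ u) u :=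
    (hasStrictFDerivAt_norm_sq u).hasFDerivAt
  have := (G_deriv (‖u‖^2)).comp_hasFDerivAt u h
  have h2 : fderiv ℝ (Psi d) u = g (‖u‖^2) • (2 • innerSL ℝ u) := this.fderiv
  rw [h2]
  simp [w, EuclideanSpace.inner_single_right]
  ring

lemma w_nonneg (d : ℕ) (u : Esp d) : 0 ≤ w d u := Real.smoothTransition.nonneg _

lemma w_pos (d : ℕ) : 0 < ∫ u, w d u :=
  (w_cd d).continuous.integral_pos_of_hasCompactSupport_nonneg_nonzero (w_cs d) (w_nonneg d)
    (x := 0) (by simp [w, g])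

lemma w_fderiv_zero (d : ℕ) (u : Esp d) (hu : 1 ≤ ‖u‖) : fderiv ℝ (w d) u = 0 := by
  apply IsLocalMin.fderiv_eq_zero
  refine Filter.Eventually.of_forall fun v => ?_
  have : w d u = 0 := g_zero (one_le_sq hu)
  rw [this]; exact w_nonneg d v

lemma mvp (d : ℕ) (R : MvPolynomial (Fin (d+1)) ℝ) (hR : ∑ i, pderiv i (pderiv i R) = 0)
    (x : Esp d) (r : ℝ) :
    ∫ u, w d u * ev d R (x + r • u) = ev d R x * ∫ u, w d u := by
  set F' : ℝ → Esp d → ℝ := fun t u => w d u * ∑ i, ev d (pderiv i R) (x + t • u) * u i with hF'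
  have hF'c : Continuous (fun q : ℝ × Esp d => F' q.1 q.2) := by
    have h1 := (w_cd d).continuous
    have h2 := fun i => ev_cont d (pderiv i R)
    fun_prop
  have hz : ∀ t, ∫ u, F' t u = 0 := by
    intro t
    have hint : ∀ i, Integrable (fun u : Esp d => w d u * (ev d (pderiv i R) (x + t • u) * u i)) := by
      intro i
      have h2 := ev_cont d (pderiv i R)
      exact cs_int (w_cd d).continuous (w_cs d) (by fun_prop)
    simp only [hF', Finset.mul_sum]
    rw [integral_finsetSum _ (fun i _ => hint i)]
    have key : ∀ i, ∫ u : Esp d, w d u * (ev d (pderiv i R) (x + t • u) * u i) =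
        -(1/2) * (t * ∫ u, Psi d u * ev d (pderiv i (pderiv i R)) (x + t • u)) := by
      intro i
      rw [ibp d (pderiv i R) x t i (Psi d) (Psi_cd d) (Psi_cs d)]
      rw [mul_neg, neg_mul, neg_neg, ← integral_const_mul]
      congr 1; ext u; rw [Psi_fderiv]; ring
    simp only [key]
    rw [← Finset.mul_sum, ← Finset.mul_sum, ← integral_finsetSum]
    · have : ∀ u : Esp d, ∑ i, Psi d u * ev d (pderiv i (pderiv i R)) (x + t • u) = 0 := by
        intro u
        rw [← Finset.mul_sum]
        have := congrArg (fun Q => ev d Q (x + t • u)) hR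
        simp only [ev, map_sum, map_zero] at this
        simp only [ev]
        rw [this, mul_zero]
      simp [this]
    · intro i _
      have h2 := ev_cont d (pderiv i (pderiv i R))
      exact cs_int (Psi_cd d).continuous (Psi_cs d) (by fun_prop)
  have hder : ∀ t, HasDerivAt (fun t : ℝ => ∫ u, w d u * ev d R (x + t • u)) 0 t := by
    intro t
    obtain ⟨B, hB⟩ := ((isCompact_closedBall t 1).prod (isCompact_closedBall (0 : Esp d) 1)).exists_bound_of_continuousOn
      hF'c.continuousOn
    have hev := ev_cont d R
    have hw := (w_cd d).continuous
    have := hasDerivAt_integral_of_dominated_loc_of_deriv_le (μ := (volume : Measure (Esp d)))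
      (F := fun (t : ℝ) (u : Esp d) => w d u * ev d R (x + t • u)) (F' := F') (x₀ := t)
      (s := Metric.closedBall t 1)
      (bound := (Metric.closedBall (0 : Esp d) 1).indicator fun _ => B)
      (Metric.closedBall_mem_nhds t one_pos)
      (Filter.Eventually.of_forall fun s => (by fun_prop : Continuous _).aestronglyMeasurable)
      (cs_int hw (w_cs d) (by fun_prop))
      ((hF'c.comp (by fun_prop : Continuous fun u : Esp d => (t, u))).aestronglyMeasurable)
      (Filter.Eventually.of_forall fun u s hs => by
        by_cases hu : u ∈ Metric.closedBall (0 : Esp d) 1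
        · rw [Set.indicator_of_mem hu]
          exact hB (s, u) ⟨hs, hu⟩
        · rw [Set.indicator_of_notMem hu]
          have : w d u = 0 := g_zero (one_le_sq (by simp at hu; exact hu.le))
          simp [hF', this])
      ((integrable_indicator_iff measurableSet_closedBall).2
        (integrableOn_const (measure_closedBall_lt_top.ne)))
      (Filter.Eventually.of_forall fun u s hs => by
        have h1 : HasDerivAt (fun s : ℝ => x + s • u) u s := by
          simpa using ((hasDerivAt_id s).smul_const u).const_add x
        have := ((ev_fderiv d R (x + s • u)).comp_hasDerivAt s h1).const_mul (w d u)
        refine HasDerivAt.congr_deriv this ?_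
        simp only [hF']
        congr 1
        simp)
    have h2 := this.2
    rwa [hz] at h2
  have hconst := is_const_of_deriv_eq_zero (fun t => (hder t).differentiableAt)
    (fun t => (hder t).deriv) r 0
  rw [hconst]
  simp only [zero_smul, add_zero]
  rw [integral_mul_const, mul_comm]

lemma grad_bound (d : ℕ) : ∃ A : ℝ, 0 < A ∧ ∀ P : MvPolynomial (Fin (d+1)) ℝ,
    ∑ i, pderiv i (pderiv i P) = 0 → ∀ (x : Esp d) (r : ℝ), 0 < r → ∀ i,
    r * |ev d (pderiv i P) x| ≤ A * ∫ u in Metric.ball (0 : Esp d) 1, |ev d P (x + r • u)| := by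
  obtain ⟨B, hB⟩ := (isCompact_closedBall (0 : Esp d) 1).exists_bound_of_continuousOn
      ((w_cd d).continuous_fderiv (by simp)).continuousOn
  have hw := w_pos d
  refine ⟨(|B| + 1) / ∫ u, w d u, by positivity, fun P hP x r hr i => ?_⟩
  have h1 := mvp d (pderiv i P) (lap_pderiv d P hP i) x r
  have h2 := ibp d P x r i (w d) (w_cd d) (w_cs d)
  rw [h1] at h2
  have hc : Continuous fun u => ev d P (x + r • u) := (ev_cont d P).comp (by fun_prop)
  have h3 : |∫ u, fderiv ℝ (w d) u (EuclideanSpace.single i 1) * ev d P (x + r • u)| ≤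
      (|B| + 1) * ∫ u in Metric.ball (0 : Esp d) 1, |ev d P (x + r • u)| := by
    rw [← setIntegral_eq_integral_of_forall_compl_eq_zero (s := Metric.ball (0 : Esp d) 1),
      ← integral_const_mul]
    · rw [← Real.norm_eq_abs]
      apply norm_integral_le_of_norm_le
      · exact ((hc.abs.const_mul _).continuousOn.integrableOn_compact
          (isCompact_closedBall (0 : Esp d) 1)).mono_set Metric.ball_subset_closedBall
      · refine (ae_restrict_iff' measurableSet_ball).2 (Filter.Eventually.of_forall fun u hu => ?_)
        rw [norm_mul, Real.norm_eq_abs (ev d P _)]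
        gcongr
        refine (ContinuousLinearMap.le_opNorm _ _).trans ?_
        rw [EuclideanSpace.norm_single, norm_one, mul_one]
        exact (hB u (Metric.ball_subset_closedBall hu)).trans ((le_abs_self B).trans (by linarith))
    · intro u hu
      rw [w_fderiv_zero d u (by simpa using hu)]
      simp
  have h4 : r * |ev d (pderiv i P) x| * ∫ u, w d u =
      |∫ u, fderiv ℝ (w d) u (EuclideanSpace.single i 1) * ev d P (x + r • u)| := by
    rw [← abs_neg (∫ u, _ * _), ← h2, abs_mul, abs_mul, abs_of_pos hr, abs_of_pos hw]; ring
  rw [div_mul_eq_mul_div, le_div_iff₀ hw, h4]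
  exact h3

lemma jensen (d : ℕ) (p : ℝ) (hp : 1 ≤ p) (f : Esp d → ℝ) (hf : Continuous f) :
    (∫ u in Metric.ball (0 : Esp d) 1, |f u|) ^ p ≤
      (volume.real (Metric.ball (0 : Esp d) 1)) ^ (p - 1) *
        ∫ u in Metric.ball (0 : Esp d) 1, |f u| ^ p := by
  have hV : 0 < volume.real (Metric.ball (0 : Esp d) 1) :=
    ENNReal.toReal_pos (Metric.measure_ball_pos _ _ one_pos).ne' measure_ball_lt_top.ne
  have hi : ∀ h : Esp d → ℝ, Continuous h → IntegrableOn h (Metric.ball (0 : Esp d) 1) :=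
    fun h hh => (hh.continuousOn.integrableOn_compact
          (isCompact_closedBall (0 : Esp d) 1)).mono_set Metric.ball_subset_closedBall
  have hcp : Continuous fun u => |f u| ^ p :=
    hf.abs.rpow_const (fun _ => Or.inr (by linarith))
  have := (convexOn_rpow hp).map_set_average_le (μ := (volume : Measure (Esp d)))
    (t := Metric.ball (0 : Esp d) 1) (f := fun u => |f u|)
    (Real.continuous_rpow_const (by linarith)).continuousOn isClosed_Ici
    (Metric.measure_ball_pos _ _ one_pos).ne' measure_ball_lt_top.ne
    (Filter.Eventually.of_forall fun u => Set.mem_Ici.2 (abs_nonneg _)) (hi _ hf.abs) (hi _ hcp)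
  simp only [setAverage_eq, smul_eq_mul] at this
  set V := volume.real (Metric.ball (0 : Esp d) 1)
  rw [Real.mul_rpow (by positivity) (by positivity), Real.inv_rpow hV.le,
    inv_mul_le_iff₀ (by positivity)] at this
  rw [Real.rpow_sub_one hV.ne']
  refine this.trans (le_of_eq ?_)
  ring

lemma scale (d : ℕ) (f : Esp d → ℝ) (x : Esp d) (r : ℝ) (hr : 0 < r) :
    ∫ u in Metric.ball (0 : Esp d) 1, f (x + r • u) =
      (r ^ (d+1))⁻¹ * ∫ v in Metric.ball x r, f v := by
  rw [← integral_indicator measurableSet_ball, ← integral_indicator measurableSet_ball]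
  have : ∀ u, (Metric.ball (0 : Esp d) 1).indicator (fun u => f (x + r • u)) u =
      (fun v => (Metric.ball x r).indicator f (x + v)) (r • u) := by
    intro u
    simp only [Set.indicator]
    congr 1
    simp [norm_smul, abs_of_pos hr, hr]
  rw [integral_congr_ae (Filter.Eventually.of_forall this)]
  rw [Measure.integral_comp_smul volume (fun v => (Metric.ball x r).indicator f (x + v)) r, integral_add_left_eq_self]
  simp [abs_of_pos hr]

end Bern

/-- Bernstein-type gradient bound: for `Q ∈ Π_L` extended harmonically to `ℝ^{d+1}` and `x`
with `||x| − 1| ≤ ε/(4L)`, `|∇Q(x)|^p ≤ C L^{d+p+1} ∫_{𝔹(x,ε/(2L))} |Q|^p dm`. -/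
theorem stmt17 (d : ℕ) (hd : 1 ≤ d) (ε p : ℝ) (hε : 0 < ε) (hp : 1 ≤ p) :
    ∃ C : ℝ, 0 < C ∧ ∀ L : ℕ, 1 ≤ L → ∀ P ∈ harmPolyLe d L, ∀ x : Esp d,
      |‖x‖ - 1| ≤ ε / (4 * L) →
      (Real.sqrt (∑ i : Fin (d+1), (eval (fun j => x j) (pderiv i P)) ^ 2)) ^ p
        ≤ C * (L : ℝ) ^ ((d : ℝ) + p + 1) *
            ∫ v in Metric.ball x (ε / (2 * L)),
              |eval (fun j => v j) P| ^ p ∂(volume : Measure (Esp d)) := by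
  obtain ⟨A, hA, hgb⟩ := Bern.grad_bound d
  set V := volume.real (Metric.ball (0 : Esp d) 1) with hVdef
  have hV : 0 < V :=
    ENNReal.toReal_pos (Metric.measure_ball_pos _ _ one_pos).ne' measure_ball_lt_top.ne
  refine ⟨((d+1) * A) ^ p * V ^ (p - 1) * (2 / ε) ^ ((d : ℝ) + p + 1), by positivity, ?_⟩
  intro L hL P hP x _
  have hL0 : (0 : ℝ) < L := by exact_mod_cast hL
  set r : ℝ := ε / (2 * L) with hr
  have hr0 : 0 < r := by positivity
  have hrinv : r⁻¹ = (2 / ε) * L := by rw [hr]; field_simp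
  set I := ∫ u in Metric.ball (0 : Esp d) 1, |Bern.ev d P (x + r • u)| with hI
  have hI0 : 0 ≤ I := by positivity
  have hb := fun i => hgb P (Bern.lap_mem d L P hP) x r hr0 i
  have h1 : Real.sqrt (∑ i : Fin (d+1), (eval (fun j => x j) (pderiv i P)) ^ 2) ≤
      ((d+1) * A) * r⁻¹ * I := by
    apply Real.sqrt_le_iff.2
    refine ⟨by positivity, ?_⟩
    have h2 : ∑ i : Fin (d+1), (eval (fun j => x j) (pderiv i P)) ^ 2 ≤
        (∑ i : Fin (d+1), |eval (fun j => x j) (pderiv i P)|) ^ 2 := by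
      simpa using Finset.sum_sq_le_sq_sum_of_nonneg (s := Finset.univ)
        (f := fun i : Fin (d+1) => |eval (fun j => x j) (pderiv i P)|) (fun i _ => abs_nonneg _)
    refine h2.trans ?_
    gcongr
    calc _ ≤ ∑ i : Fin (d+1), A * r⁻¹ * I := by
          gcongr with i
          have := hb i
          rw [← le_div_iff₀' hr0] at this
          refine this.trans (le_of_eq ?_)
          rw [div_eq_mul_inv]; ring
      _ = _ := by simp; ring
  have hJ := Bern.jensen d p hp (fun u => Bern.ev d P (x + r • u))
    ((Bern.ev_cont d P).comp (by fun_prop))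
  have hS := Bern.scale d (fun v => |Bern.ev d P v| ^ p) x r hr0
  rw [hS] at hJ
  have hrr : r⁻¹ ^ p * (r ^ (d+1))⁻¹ = (2/ε) ^ ((d : ℝ) + p + 1) * (L : ℝ) ^ ((d : ℝ) + p + 1) := by
    rw [← Real.mul_rpow (by positivity) hL0.le, ← hrinv, ← inv_pow, ← Real.rpow_natCast,
      ← Real.rpow_add (by positivity)]
    congr 1; push_cast; ring
  calc _ ≤ (((d+1) * A) * r⁻¹ * I) ^ p := by gcongr
    _ = ((d+1) * A) ^ p * r⁻¹ ^ p * I ^ p := by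
        rw [Real.mul_rpow (by positivity) hI0, Real.mul_rpow (by positivity) (by positivity)]
    _ ≤ ((d+1) * A) ^ p * r⁻¹ ^ p * (V ^ (p-1) * ((r ^ (d+1))⁻¹ * ∫ v in Metric.ball x r, |Bern.ev d P v| ^ p)) := by
        gcongr
    _ = ((d+1) * A) ^ p * V ^ (p-1) * (r⁻¹ ^ p * (r ^ (d+1))⁻¹) * ∫ v in Metric.ball x r, |Bern.ev d P v| ^ p := by ring
    _ = _ := by rw [hrr]; simp only [Bern.ev]; ring

end
end
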